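/- arXiv:2310.05788 — 10 statements merged into one kernel-verified Lean document; each statement's English description precedes it below -/
import Mathlib

section
/- Let n be a positive integer and S ⊆ Z_n \ {0}. Then the rank over ℂ of the walk matrix W_0 of the Cayley digraph Cay(Z_n,S) equals the number of distinct eigenvalues of Cay(Z_n,S); that is, rank_ℂ(W_0) = |{λ_{a,S} : a ∈ Z_n}|. -/
/-- `ζ_n = exp(-2πi/n)`. -/
noncomputable def zetaC (n : ℕ) : ℂ := Complex.exp (-(2 * Real.pi * Complex.I) / n)

/-- The adjacency matrix of the Cayley digraph `Cay(Z_n, S)`. -/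
noncomputable def cayAdj (n : ℕ) (S : Finset (ZMod n)) : Matrix (ZMod n) (ZMod n) ℂ :=
  fun x y => if y - x ∈ S then 1 else 0

/-- The eigenvalue `λ_{a,S} = ∑_{j ∈ S} ζ_n^{a·j}` of `Cay(Z_n, S)`. -/
noncomputable def cayEig (n : ℕ) (S : Finset (ZMod n)) (a : ZMod n) : ℂ :=
  ∑ j ∈ S, zetaC n ^ (a * j).val

/-- The walk matrix `W_0` of `Cay(Z_n, S)` with vertex `0` individualized:
its `(x,k)` entry is the number of walks of length `k` from `x` to `0`,
i.e. `(A^k)_{x,0}`. -/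
noncomputable def walkMatrix (n : ℕ) [NeZero n] (S : Finset (ZMod n)) :
    Matrix (ZMod n) (ZMod n) ℂ :=
  fun x k => (cayAdj n S ^ k.val) x 0

theorem zetaC_pow_val (n : ℕ) [NeZero n] (j : ZMod n) :
    zetaC n ^ j.val = ZMod.stdAddChar (-j) := by
  rw [AddChar.map_neg_eq_inv, ZMod.stdAddChar_apply, ZMod.toCircle_apply, zetaC,
    ← Complex.exp_nat_mul, ← Complex.exp_neg]
  congr 1
  ring

theorem cayEig_eq_sum_stdAddChar (n : ℕ) [NeZero n] (S : Finset (ZMod n)) (a : ZMod n) :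
    cayEig n S a = ∑ j ∈ S, (ZMod.stdAddChar (-(a * j)) : ℂ) :=
  Finset.sum_congr rfl fun _ _ => zetaC_pow_val n _

/-- The character table of `Z_n`. -/
noncomputable def charMatrix (n : ℕ) [NeZero n] : Matrix (ZMod n) (ZMod n) ℂ :=
  Matrix.of fun a x => ZMod.stdAddChar (a * x)

theorem isUnit_det_charMatrix (n : ℕ) [NeZero n] : IsUnit (charMatrix n).det := by
  have hn : (n : ℂ) ≠ 0 := Nat.cast_ne_zero.mpr (NeZero.ne n)
  refine Matrix.isUnit_det_of_right_inverse
    (B := (n : ℂ)⁻¹ • Matrix.of fun x b => ZMod.stdAddChar (-(x * b))) ?_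
  ext a b
  have h := AddChar.sum_mulShift (a - b) (ZMod.isPrimitive_stdAddChar n)
  rw [ZMod.card] at h
  have hmul : ∀ x : ZMod n, (ZMod.stdAddChar (a * x) : ℂ) * ZMod.stdAddChar (-(x * b)) =
      ZMod.stdAddChar (x * (a - b)) := fun x => by
    rw [← AddChar.map_add_eq_mul]
    ring_nf
  rw [Matrix.mul_smul, Matrix.smul_apply, Matrix.mul_apply]
  simp only [charMatrix, Matrix.of_apply, hmul, h, Matrix.one_apply, sub_eq_zero]
  split_ifs <;> simp [hn]

theorem charMatrix_mul_cayAdj (n : ℕ) [NeZero n] (S : Finset (ZMod n)) :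
    charMatrix n * cayAdj n S = Matrix.diagonal (cayEig n S) * charMatrix n := by
  ext a y
  rw [Matrix.diagonal_mul, Matrix.mul_apply, cayEig_eq_sum_stdAddChar, Finset.sum_mul,
    ← Equiv.sum_comp (Equiv.subLeft y)]
  simp only [charMatrix, cayAdj, Matrix.of_apply, Equiv.subLeft_apply, sub_sub_cancel, mul_ite, mul_one, mul_zero,
    Finset.sum_ite_mem, Finset.univ_inter, ← AddChar.map_add_eq_mul]
  refine Finset.sum_congr rfl fun j _ => ?_
  ring_nf

theorem charMatrix_mul_cayAdj_pow (n : ℕ) [NeZero n] (S : Finset (ZMod n)) (k : ℕ) :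
    charMatrix n * cayAdj n S ^ k = Matrix.diagonal (cayEig n S) ^ k * charMatrix n := by
  induction k with
  | zero => simp
  | succ k ih =>
    rw [pow_succ, ← Matrix.mul_assoc, ih, Matrix.mul_assoc, charMatrix_mul_cayAdj,
      ← Matrix.mul_assoc, ← pow_succ]

theorem charMatrix_mul_walkMatrix (n : ℕ) [NeZero n] (S : Finset (ZMod n)) :
    charMatrix n * walkMatrix n S = Matrix.of fun a k => cayEig n S a ^ k.val := by
  ext a k
  have h := congrFun (congrFun (charMatrix_mul_cayAdj_pow n S k.val) a) 0
  rw [Matrix.diagonal_pow, Matrix.diagonal_mul] at h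
  simpa [Matrix.mul_apply, walkMatrix, charMatrix] using h

theorem linearIndependent_pow_val (n : ℕ) [NeZero n] (T : Finset ℂ) (hT : T.card ≤ n) :
    LinearIndependent ℂ (fun (t : T) (k : ZMod n) => (t : ℂ) ^ k.val) := by
  rw [← linearIndependent_equiv T.equivFin.symm, Fintype.linearIndependent_iff]
  intro g hg
  refine congrFun (Matrix.eq_zero_of_forall_pow_sum_mul_pow_eq_zero
    (f := fun i => (T.equivFin.symm i : ℂ))
    (Subtype.val_injective.comp T.equivFin.symm.injective) fun i => ?_)
  have h := congrFun hg (i : ℕ)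
  simpa [ZMod.val_natCast_of_lt (i.2.trans_le hT)] using h

theorem rank_pow_val (n : ℕ) [NeZero n] (μ : ZMod n → ℂ) :
    (Matrix.of fun a k : ZMod n => μ a ^ k.val).rank =
      (Finset.image μ Finset.univ).card := by
  have hT : (Finset.image μ Finset.univ).card ≤ n :=
    Finset.card_image_le.trans_eq (by rw [Finset.card_univ, ZMod.card])
  have hli := linearIndependent_pow_val n _ hT
  have hrange : Set.range (Matrix.of fun a k : ZMod n => μ a ^ k.val).row =
      Set.range fun (t : Finset.image μ Finset.univ) (k : ZMod n) => (t : ℂ) ^ k.val := by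
    ext v
    simp only [Set.mem_range, Subtype.exists, Finset.mem_image, Finset.mem_univ, true_and]
    constructor
    · rintro ⟨a, rfl⟩
      exact ⟨μ a, ⟨a, rfl⟩, rfl⟩
    · rintro ⟨_, ⟨a, rfl⟩, rfl⟩
      exact ⟨a, rfl⟩
  rw [Matrix.rank_eq_finrank_span_row, ← Fintype.card_coe, ← finrank_span_eq_card hli, hrange]

theorem stmt0 (n : ℕ) [NeZero n] (S : Finset (ZMod n)) (hS : (0 : ZMod n) ∉ S) :
    (walkMatrix n S).rank = (Finset.image (cayEig n S) Finset.univ).card := by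
  rw [← rank_pow_val, ← charMatrix_mul_walkMatrix,
    Matrix.rank_mul_eq_right_of_isUnit_det _ _ (isUnit_det_charMatrix n)]
end

section
/- Let n be a positive integer and S ⊆ Z_n \ {0}. The walk matrix W_0 of the Cayley digraph Cay(Z_n,S) is non-singular (invertible over ℂ) if and only if Cay(Z_n,S) has simple spectrum, i.e., the n values λ_{a,S} for a ∈ Z_n are pairwise distinct. -/
theorem isPrimitiveRoot_zetaC (n : ℕ) [NeZero n] : IsPrimitiveRoot (zetaC n) n := by
  have h := (Complex.isPrimitiveRoot_exp n (NeZero.ne n)).inv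
  rwa [← Complex.exp_neg, ← neg_div] at h

theorem zetaC_pow_val_add {n : ℕ} [NeZero n] (x y : ZMod n) :
    zetaC n ^ (x + y).val = zetaC n ^ x.val * zetaC n ^ y.val := by
  rw [ZMod.val_add, ← pow_eq_pow_mod _ (isPrimitiveRoot_zetaC n).pow_eq_one, pow_add]

theorem zetaC_pow_val_mul {n : ℕ} [NeZero n] (x y : ZMod n) :
    zetaC n ^ (x * y).val = (zetaC n ^ x.val) ^ y.val := by
  rw [ZMod.val_mul, ← pow_eq_pow_mod _ (isPrimitiveRoot_zetaC n).pow_eq_one, pow_mul]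

theorem zetaC_pow_val_injective (n : ℕ) [NeZero n] :
    Function.Injective fun x : ZMod n => zetaC n ^ x.val := fun x y h =>
  ZMod.val_injective n
    ((isPrimitiveRoot_zetaC n).pow_inj (ZMod.val_lt x) (ZMod.val_lt y) h)

/-- The Vandermonde matrix of `v`, with rows and columns indexed by `ZMod n`. -/
def zmodVandermonde (n : ℕ) (v : ZMod n → ℂ) : Matrix (ZMod n) (ZMod n) ℂ :=
  fun a k => v a ^ k.val

theorem isUnit_zmodVandermonde_iff {n : ℕ} [NeZero n] (v : ZMod n → ℂ) :
    IsUnit (zmodVandermonde n v) ↔ Function.Injective v := by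
  obtain ⟨m, rfl⟩ := Nat.exists_eq_succ_of_ne_zero (NeZero.ne n)
  rw [Matrix.isUnit_iff_isUnit_det, isUnit_iff_ne_zero]
  exact Matrix.det_vandermonde_ne_zero_iff (n := m + 1) (v := v)

/-- The rows of the Fourier matrix are left eigenvectors of the adjacency matrix. -/
theorem fourier_mul_cayAdj {n : ℕ} [NeZero n] (S : Finset (ZMod n)) :
    zmodVandermonde n (fun a => zetaC n ^ (-a).val) * cayAdj n S =
      Matrix.diagonal (cayEig n S) * zmodVandermonde n (fun a => zetaC n ^ (-a).val) := by
  ext a y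
  rw [Matrix.diagonal_mul, Matrix.mul_apply, ← (Equiv.subLeft y).sum_comp]
  simp only [zmodVandermonde, cayAdj, cayEig, Equiv.subLeft_apply, sub_sub_cancel,
    mul_ite, mul_one, mul_zero, Finset.sum_ite_mem, Finset.univ_inter, Finset.sum_mul,
    ← zetaC_pow_val_mul, ← zetaC_pow_val_add]
  refine Finset.sum_congr rfl fun j _ => ?_
  congr 2
  ring

theorem fourier_mul_cayAdj_pow {n : ℕ} [NeZero n] (S : Finset (ZMod n)) (k : ℕ) :
    zmodVandermonde n (fun a => zetaC n ^ (-a).val) * cayAdj n S ^ k =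
      Matrix.diagonal (cayEig n S) ^ k *
        zmodVandermonde n (fun a => zetaC n ^ (-a).val) := by
  have h : SemiconjBy (zmodVandermonde n fun a => zetaC n ^ (-a).val) (cayAdj n S)
      (Matrix.diagonal (cayEig n S)) := fourier_mul_cayAdj S
  exact h.pow_right k

theorem fourier_mul_walkMatrix {n : ℕ} [NeZero n] (S : Finset (ZMod n)) :
    zmodVandermonde n (fun a => zetaC n ^ (-a).val) * walkMatrix n S =
      zmodVandermonde n (cayEig n S) := by
  ext a k
  have h := congrFun (congrFun (fourier_mul_cayAdj_pow S k.val) a) 0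
  rw [Matrix.diagonal_pow, Matrix.diagonal_mul, Matrix.mul_apply] at h
  rw [Matrix.mul_apply]
  refine h.trans ?_
  simp [zmodVandermonde]

/-- The walk matrix `W_0` of `Cay(Z_n,S)` is non-singular iff `Cay(Z_n,S)` has
simple spectrum, i.e. the `n` values `λ_{a,S}` are pairwise distinct. -/
theorem stmt1 (n : ℕ) [NeZero n] (S : Finset (ZMod n)) (hS : (0 : ZMod n) ∉ S) :
    IsUnit (walkMatrix n S) ↔ Function.Injective (cayEig n S) := by
  have hF : IsUnit (zmodVandermonde n fun a => zetaC n ^ (-a).val) :=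
    (isUnit_zmodVandermonde_iff _).2 ((zetaC_pow_val_injective n).comp neg_injective)
  rw [← isUnit_zmodVandermonde_iff, ← fourier_mul_walkMatrix]
  exact (hF.mul_left_iff).symm
end

section
/- Let n be a positive integer and S ⊆ Z_n \ {0} with S = −S, and suppose Cay(Z_n,S) with vertex 0 individualized is walk-saturated, i.e., the number of distinct rows of its walk matrix W_0 equals ⌈(n+1)/2⌉. Fix u ∈ Z_n with u ≠ 0 and 2u ≠ 0. Then for any two distinct vertices x, y ∈ Z_n there exists k ∈ {0,…,n−1} such that (A^k)_{x,0} ≠ (A^k)_{y,0} or (A^k)_{x,u} ≠ (A^k)_{y,u}; equivalently, the pairs of row vectors (W_0(x), W_u(x)) are pairwise distinct over x ∈ Z_n, where W_u(x) = ((A^k)_{x,u})_{k=0}^{n−1}. -/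
/-- The row of the walk matrix `W_u` corresponding to vertex `x`:
`W_u(x) = ((A^k)_{x,u})_{k=0}^{n-1}`. -/
noncomputable def walkRow (n : ℕ) [NeZero n] (S : Finset (ZMod n)) (u x : ZMod n) :
    ZMod n → ℂ :=
  fun k => (cayAdj n S ^ k.val) x u

/-- Powers of a matrix invariant under a permutation of the indices are again invariant. -/
theorem Matrix.pow_apply_equiv {ι R : Type*} [Fintype ι] [DecidableEq ι] [Semiring R]
    {A : Matrix ι ι R} (e : ι ≃ ι) (h : ∀ x y, A (e x) (e y) = A x y) (k : ℕ) (x y : ι) :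
    (A ^ k) (e x) (e y) = (A ^ k) x y := by
  induction k generalizing y with
  | zero => simp [Matrix.one_apply]
  | succ k ih =>
    rw [pow_succ, Matrix.mul_apply, Matrix.mul_apply, ← Equiv.sum_comp e]
    simp [h, ih]

/-- An even function on `ZMod n` taking at least `n / 2 + 1` values separates points up to sign. -/
theorem ZMod.eq_or_eq_neg_of_even_of_le_ncard {n : ℕ} [NeZero n] {α : Type*} {f : ZMod n → α}
    (hf : ∀ x, f (-x) = f x) (hcard : n / 2 + 1 ≤ (Set.range f).ncard) {x y : ZMod n}
    (hxy : f x = f y) : x = y ∨ x = -y := by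
  classical
  have hrep (z : ZMod n) : f z = f (z.valMinAbs.natAbs : ZMod n) := by
    rcases Int.natAbs_eq z.valMinAbs with h | h
    · conv_lhs => rw [← ZMod.coe_valMinAbs z, h, Int.cast_natCast]
    · conv_lhs => rw [← ZMod.coe_valMinAbs z, h, Int.cast_neg, Int.cast_natCast, hf]
  have hmem (z : ZMod n) : z.valMinAbs.natAbs ∈ Finset.range (n / 2 + 1) :=
    Finset.mem_range_succ_iff.mpr (ZMod.natAbs_valMinAbs_le z)
  have himage : Set.range f ⊆ (Finset.range (n / 2 + 1)).image fun i : ℕ => f i := by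
    rintro _ ⟨z, rfl⟩
    exact Finset.mem_coe.mpr (Finset.mem_image.mpr ⟨_, hmem z, (hrep z).symm⟩)
  have hle := Set.ncard_le_ncard himage (Finset.finite_toSet _)
  rw [Set.ncard_coe_finset] at hle
  have hinj : Set.InjOn (fun i : ℕ => f i) (Finset.range (n / 2 + 1)) :=
    Finset.card_image_iff.mp
      (le_antisymm Finset.card_image_le (by rw [Finset.card_range]; exact hcard.trans hle))
  exact ZMod.natAbs_valMinAbs_eq_natAbs_valMinAbs.mp
    (hinj (hmem x) (hmem y) (by simpa only [← hrep] using hxy))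

theorem cayAdj_pow_sub_right (n : ℕ) [NeZero n] (S : Finset (ZMod n)) (k : ℕ) (x u : ZMod n) :
    (cayAdj n S ^ k) (x - u) 0 = (cayAdj n S ^ k) x u := by
  simpa using Matrix.pow_apply_equiv (A := cayAdj n S) (Equiv.subRight u)
    (fun x y => by simp [cayAdj]) k x u

theorem cayAdj_pow_neg_zero (n : ℕ) [NeZero n] (S : Finset (ZMod n))
    (hsym : ∀ x : ZMod n, x ∈ S ↔ -x ∈ S) (k : ℕ) (x : ZMod n) :
    (cayAdj n S ^ k) (-x) 0 = (cayAdj n S ^ k) x 0 := by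
  simpa using Matrix.pow_apply_equiv (A := cayAdj n S) (Equiv.neg (ZMod n))
    (fun x y => by
      have h : -y - -x = -(y - x) := by ring
      simp only [cayAdj, Equiv.neg_apply, h, ← hsym]) k x 0

/-- If `Cay(Z_n,S)` (with `S = -S`) with vertex `0` individualized is walk-saturated,
i.e. the number of distinct rows of `W_0` equals `⌈(n+1)/2⌉ = (n+2)/2`, and `u ≠ 0`,
`2u ≠ 0`, then the pairs of rows `(W_0(x), W_u(x))` are pairwise distinct. -/
theorem stmt3 (n : ℕ) [NeZero n] (S : Finset (ZMod n)) (hS : (0 : ZMod n) ∉ S)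
    (hsym : ∀ x : ZMod n, x ∈ S ↔ -x ∈ S)
    (hsat : (Set.range (fun x : ZMod n => walkRow n S 0 x)).ncard = (n + 2) / 2)
    (u : ZMod n) (hu : u ≠ 0) (hu2 : 2 * u ≠ 0) :
    ∀ x y : ZMod n, x ≠ y →
      ∃ k : ZMod n, (cayAdj n S ^ k.val) x 0 ≠ (cayAdj n S ^ k.val) y 0 ∨
        (cayAdj n S ^ k.val) x u ≠ (cayAdj n S ^ k.val) y u := by
  have hsep {x y : ZMod n} (h : walkRow n S 0 x = walkRow n S 0 y) : x = y ∨ x = -y :=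
    ZMod.eq_or_eq_neg_of_even_of_le_ncard (f := walkRow n S 0)
      (fun z => funext fun k => cayAdj_pow_neg_zero n S hsym k.val z)
      (by change _ ≤ (Set.range fun x => walkRow n S 0 x).ncard; omega) h
  intro x y hxy
  by_contra! hrows
  have hneg : x = -y := (hsep (funext fun k => (hrows k).1)).resolve_left hxy
  have hshift : walkRow n S 0 (x - u) = walkRow n S 0 (y - u) := by
    funext k
    simpa only [walkRow, cayAdj_pow_sub_right] using (hrows k).2
  rcases hsep hshift with h | h
  · exact hxy (sub_left_inj.mp h)
  · exact hu2 (by linear_combination hneg - h)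
end

section
/- Let G be a finite digraph on vertex set V with edge relation E ⊆ V×V, let t ∈ V, and let the color refinement colorings C_i be defined from the initial coloring that distinguishes only t. Then for every k ≥ 0 and all x, x' ∈ V: if the number of walks of length k from x to t differs from the number of walks of length k from x' to t, then C_k(x) ≠ C_k(x'). -/
/-- The type of colors after `i` rounds of color refinement: the initial color is a
Boolean, and the color after `i+1` rounds is the pair of the color after `i` rounds
and a multiset of colors after `i` rounds (of the out-neighbors). -/
def CRColor : ℕ → Type
  | 0 => Bool
  | (i + 1) => CRColor i × Multiset (CRColor i)

/-- Color refinement on the digraph `(V, E)` started from the coloring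
distinguishing only the vertex `t`:
`C_0(x) = (x = t)` and `C_{i+1}(x) = (C_i(x), {{C_i(y) : y ∈ N(x)}})`,
where `N(x) = {y : (x,y) ∈ E}` is the out-neighborhood of `x`. -/
def crColoring {V : Type*} [Fintype V] [DecidableEq V] (E : V → V → Prop)
    [DecidableRel E] (t : V) : (i : ℕ) → V → CRColor i
  | 0, x => decide (x = t)
  | (i + 1), x =>
      (crColoring E t i x,
        (Finset.univ.filter (fun y => E x y)).val.map (crColoring E t i))

/-- The number of walks of length `k` from `x` to `t` in the digraph `(V, E)`. -/
def walkCount {V : Type*} [Fintype V] [DecidableEq V] (E : V → V → Prop)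
    [DecidableRel E] (t : V) : ℕ → V → ℕ
  | 0, x => if x = t then 1 else 0
  | (k + 1), x => ∑ y ∈ Finset.univ.filter (fun y => E x y), walkCount E t k y

/-- The number of walks of length `k` to the distinguished vertex, read off from the
color after `k` rounds. -/
def CRColor.walkCount : (k : ℕ) → CRColor k → ℕ
  | 0, b => Bool.toNat b
  | (k + 1), c => (c.2.map (CRColor.walkCount k)).sum

theorem CRColor.walkCount_crColoring {V : Type*} [Fintype V] [DecidableEq V]
    (E : V → V → Prop) [DecidableRel E] (t : V) (k : ℕ) (x : V) :
    CRColor.walkCount k (crColoring E t k x) = _root_.walkCount E t k x := by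
  induction k generalizing x with
  | zero => by_cases hx : x = t <;> simp [CRColor.walkCount, crColoring, _root_.walkCount, hx]
  | succ k ih =>
    simp only [CRColor.walkCount, crColoring, _root_.walkCount, Multiset.map_map,
      Function.comp_def, ih]
    rfl

/-- If the numbers of walks of length `k` from `x` and from `x'` to `t` differ,
then color refinement (initialized by distinguishing only `t`) assigns `x` and
`x'` different colors after `k` rounds. -/
theorem stmt4 {V : Type*} [Fintype V] [DecidableEq V] (E : V → V → Prop)
    [DecidableRel E] (t : V) (k : ℕ) (x x' : V)
    (h : walkCount E t k x ≠ walkCount E t k x') :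
    crColoring E t k x ≠ crColoring E t k x' := by
  intro hc
  apply h
  rw [← CRColor.walkCount_crColoring, hc, CRColor.walkCount_crColoring]
end

section
/- For every ε > 0 there exists N such that for all n ≥ N: the number of inverse-closed subsets S ⊆ Z_n \ {0} (i.e., with S = −S) for which |{λ_{a,S} : a ∈ Z_n}| < ⌈(n+1)/2⌉ is at most n^{−1/2+ε}·2^{⌊n/2⌋}. Equivalently, a uniformly random inverse-closed S gives a Cayley graph Cay(Z_n,S) with saturated spectrum with probability at least 1 − n^{−1/2+ε}. -/
theorem choose_sq_mul_succ_le_four_pow (k r : ℕ) : k.choose r ^ 2 * (k + 1) ≤ 4 ^ k := by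
  have central : ∀ m : ℕ, m.centralBinom ^ 2 * (2 * m + 1) ≤ 16 ^ m := by
    intro m
    induction m with
    | zero => simp
    | succ m ih =>
      have h := Nat.succ_mul_centralBinom_succ m
      have h2 : (m + 1) ^ 2 * ((m + 1).centralBinom ^ 2 * (2 * (m + 1) + 1))
          ≤ (m + 1) ^ 2 * 16 ^ (m + 1) := by
        calc (m + 1) ^ 2 * ((m + 1).centralBinom ^ 2 * (2 * (m + 1) + 1))
            = ((m + 1) * (m + 1).centralBinom) ^ 2 * (2 * m + 3) := by ring
          _ = (m.centralBinom ^ 2 * (2 * m + 1)) * (4 * ((2 * m + 1) * (2 * m + 3))) := by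
              rw [h]; ring
          _ ≤ 16 ^ m * (4 * (4 * (m + 1) ^ 2)) := by
              exact Nat.mul_le_mul ih (Nat.mul_le_mul_left 4 (by nlinarith))
          _ = _ := by ring
      exact Nat.le_of_mul_le_mul_left h2 (by positivity)
  refine le_trans (Nat.mul_le_mul_right _ (Nat.pow_le_pow_left (Nat.choose_le_middle r k) 2)) ?_
  obtain ⟨m, rfl | rfl⟩ := Nat.even_or_odd' k
  · have h := central m
    rw [Nat.centralBinom_eq_two_mul_choose] at h
    rw [Nat.mul_div_cancel_left m two_pos, pow_mul]
    exact h
  · have h := central (m + 1)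
    rw [Nat.centralBinom_eq_two_mul_choose, show 2 * (m + 1) = (2 * m + 1) + 1 by ring,
      Nat.choose_succ_succ,
      show (2 * m + 1).choose (m + 1) = (2 * m + 1).choose m from Nat.choose_symm_half m] at h
    rw [show (2 * m + 1) / 2 = m by omega]
    have h4 : (4 : ℕ) ^ (2 * m + 1) * 4 = 16 ^ (m + 1) := by
      rw [← pow_succ, show 2 * m + 1 + 1 = 2 * (m + 1) by ring, pow_mul]; norm_num
    nlinarith [Nat.zero_le ((2 * m + 1).choose m ^ 2)]

theorem le_two_mul_totient_sq (m : ℕ) : m ≤ 2 * m.totient ^ 2 := by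
  suffices h : m ≤ 2 * m.totient ^ 2 ∧ (Odd m → m ≤ m.totient ^ 2) from h.1
  induction m using Nat.recOnPosPrimePosCoprime with
  | zero => simp
  | one => simp
  | prime_pow p k hp hk =>
    obtain ⟨k, rfl⟩ := Nat.exists_eq_add_of_lt hk
    simp only [zero_add]
    rw [Nat.totient_prime_pow_succ hp]
    have hone : 1 ≤ p ^ k := Nat.one_le_pow _ _ hp.pos
    obtain ⟨q, rfl⟩ := Nat.exists_eq_add_of_le hp.two_le
    have hq : 2 + q - 1 = q + 1 := by omega
    rw [hq]
    rw [pow_succ]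
    generalize (2 + q) ^ k = x at *
    have hx : x ≤ x ^ 2 := Nat.le_self_pow two_ne_zero x
    constructor
    · calc x * (2 + q) ≤ x ^ 2 * (2 * (q + 1) ^ 2) := Nat.mul_le_mul hx (by nlinarith)
        _ = _ := by ring
    · intro hodd
      have hq1 : 1 ≤ q := by
        rcases Nat.eq_zero_or_pos q with rfl | h
        · exact absurd hodd (Nat.not_odd_iff_even.2 (even_two.mul_left x))
        · exact h
      calc x * (2 + q) ≤ x ^ 2 * (q + 1) ^ 2 := Nat.mul_le_mul hx (by nlinarith)
        _ = _ := by ring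
  | coprime a b ha hb hab iha ihb =>
    rw [Nat.totient_mul hab]
    constructor
    · rcases Nat.even_or_odd a with h | h
      · have hb' : Odd b := by
          rw [← Nat.not_even_iff_odd]
          intro h'
          have := Nat.dvd_gcd h.two_dvd h'.two_dvd
          rw [hab] at this
          omega
        calc a * b ≤ (2 * a.totient ^ 2) * b.totient ^ 2 := Nat.mul_le_mul iha.1 (ihb.2 hb')
          _ = _ := by ring
      · calc a * b ≤ a.totient ^ 2 * (2 * b.totient ^ 2) := Nat.mul_le_mul (iha.2 h) ihb.1
          _ = _ := by ring
    · intro h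
      obtain ⟨h1, h2⟩ := Nat.odd_mul.1 h
      rw [mul_pow]
      exact Nat.mul_le_mul (iha.2 h1) (ihb.2 h2)

theorem exists_independent_card_le {W : Type*} [Fintype W] [DecidableEq W] (R : W → W → Prop)
    [DecidableRel R] (hrefl : ∀ w, R w w) (hsymm : ∀ w w', R w w' → R w' w) (d : ℕ)
    (hd : ∀ w, (Finset.univ.filter (R w)).card ≤ d) :
    ∃ U : Finset W, (∀ u ∈ U, ∀ v ∈ U, R u v → u = v) ∧ Fintype.card W ≤ d * U.card := by
  obtain ⟨U, hU⟩ := (Set.toFinite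
    {U : Finset W | ∀ u ∈ U, ∀ v ∈ U, R u v → u = v}).exists_maximal ⟨∅, by simp⟩
  refine ⟨U, hU.prop, ?_⟩
  have hcover : Finset.univ ⊆ U.biUnion (fun u => Finset.univ.filter (R u)) := by
    intro w _
    simp only [Finset.mem_biUnion, Finset.mem_filter, Finset.mem_univ, true_and]
    by_contra! hw
    have hwU : w ∉ U := fun h => hw w h (hrefl w)
    have hins : insert w U ∈ {U : Finset W | ∀ u ∈ U, ∀ v ∈ U, R u v → u = v} := by
      intro u hu v hv huv
      rw [Finset.mem_insert] at hu hv
      rcases hu with rfl | hu <;> rcases hv with rfl | hv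
      · rfl
      · exact absurd (hsymm _ _ huv) (hw v hv)
      · exact absurd huv (hw u hu)
      · exact hU.prop u hu v hv huv
    exact hwU (hU.le_of_ge hins (Finset.subset_insert w U) (Finset.mem_insert_self w U))
  calc Fintype.card W = (Finset.univ : Finset W).card := rfl
    _ ≤ _ := Finset.card_le_card hcover
    _ ≤ U.card * d := Finset.card_biUnion_le_card_mul _ _ _ (fun u _ => hd u)
    _ = _ := mul_comm _ _

theorem card_zero_sum_sq_mul_le {ι : Type*} [DecidableEq ι] (H C : Finset ι) (hC : C ⊆ H)
    (v : ι → ℂ) (c : ℂ) (hc : c ≠ 0) (hv : ∀ j ∈ C, v j = c) :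
    (H.powerset.filter (fun T => ∑ j ∈ T, v j = 0)).card ^ 2 * (C.card + 1) ≤ 4 ^ H.card := by
  set k := C.card
  have hfib : ∀ R ∈ (H \ C).powerset,
      ((H.powerset.filter (fun T => ∑ j ∈ T, v j = 0)).filter (fun T => T \ C = R)).card ≤
        k.choose (k / 2) := by
    intro R _
    have hsum : ∀ T : Finset ι, T \ C = R → ∑ j ∈ T, v j = 0 →
        ((T ∩ C).card : ℂ) = -(∑ j ∈ R, v j) / c := by
      intro T hT h0
      rw [← Finset.sum_inter_add_sum_sdiff T C v, hT,
        Finset.sum_congr rfl (fun j hj => hv j (Finset.mem_inter.1 hj).2), Finset.sum_const,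
        nsmul_eq_mul] at h0
      rw [eq_div_iff hc]
      linear_combination h0
    rcases Finset.eq_empty_or_nonempty ((H.powerset.filter (fun T => ∑ j ∈ T, v j = 0)).filter
      (fun T => T \ C = R)) with he | ⟨T₀, hT₀⟩
    · simp [he]
    · simp only [Finset.mem_filter] at hT₀
      refine le_trans ?_ (Nat.choose_le_middle (T₀ ∩ C).card k)
      rw [← Finset.card_powersetCard]
      refine Finset.card_le_card_of_injOn (fun T => T ∩ C) ?_ ?_
      · intro T hT
        simp only [Finset.coe_filter, Finset.mem_filter, Set.mem_ofPred_eq] at hT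
        rw [Finset.mem_coe, Finset.mem_powersetCard]
        refine ⟨Finset.inter_subset_right, ?_⟩
        have := (hsum T hT.2 hT.1.2).trans (hsum T₀ hT₀.2 hT₀.1.2).symm
        exact_mod_cast this
      · intro T hT T' hT' h
        simp only [Finset.coe_filter, Finset.mem_filter, Set.mem_ofPred_eq] at hT hT'
        rw [← Finset.sdiff_union_inter T C, ← Finset.sdiff_union_inter T' C, hT.2, hT'.2]
        exact congrArg _ h
  have hcard := Finset.card_le_mul_card_image_of_maps_to
    (s := H.powerset.filter (fun T => ∑ j ∈ T, v j = 0)) (t := (H \ C).powerset)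
    (f := fun T => T \ C)
    (fun T hT => Finset.mem_powerset.2 (Finset.sdiff_subset_sdiff
      (Finset.mem_powerset.1 (Finset.mem_filter.1 hT).1) subset_rfl)) _ hfib
  rw [Finset.card_powerset] at hcard
  have hH : H.card = (H \ C).card + k := (Finset.card_sdiff_add_card_eq_card hC).symm
  calc _ ≤ (k.choose (k / 2) * 2 ^ (H \ C).card) ^ 2 * (k + 1) := by gcongr
    _ = (2 ^ 2) ^ (H \ C).card * (k.choose (k / 2) ^ 2 * (k + 1)) := by
        rw [← pow_mul, mul_comm 2, pow_mul]; ring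
    _ ≤ (2 ^ 2) ^ (H \ C).card * 4 ^ k := by gcongr; exact choose_sq_mul_succ_le_four_pow _ _
    _ = _ := by rw [hH, pow_add]; norm_num

theorem card_common_zero_sum_mul_le {ι U : Type*} [DecidableEq ι] [Fintype U] (H : Finset ι)
    (L : U → ι → ℂ)
    (hL : ∀ θ : U → ℂ, (∀ j ∈ H, ∑ u, θ u * L u j = 0) → θ = 0) :
    (H.powerset.filter (fun T => ∀ u, ∑ j ∈ T, L u j = 0)).card * 2 ^ Fintype.card U ≤
      2 ^ H.card := by
  classical
  let A : Matrix U H ℂ := fun u j => L u j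
  have hrows : LinearIndependent ℂ A.row := by
    rw [Fintype.linearIndependent_iff]
    intro θ hθ
    refine fun u => congrFun (hL θ fun j hj => ?_) u
    have := congrFun hθ ⟨j, hj⟩
    simpa [A, Matrix.row] using this
  have hrank := hrows.rank_matrix
  rw [Matrix.rank_eq_finrank_span_cols] at hrank
  obtain ⟨f, hf, -, hli⟩ := Submodule.exists_fun_fin_finrank_span_eq ℂ (Set.range A.col)
  choose g hg using hf
  have hginj : Function.Injective fun i => (g i : ι) := fun i i' h =>
    hli.injective (by rw [← hg i, ← hg i', Subtype.ext h])
  set J : Finset ι := Finset.univ.map ⟨_, hginj⟩ with hJ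
  have hJcard : J.card = Fintype.card U := by simp [hJ, hrank]
  have hJH : J ⊆ H := by
    intro j hj
    obtain ⟨i, -, rfl⟩ := Finset.mem_map.1 hj
    exact (g i).2
  have hsplit : ∀ (T : Finset ι) (u : U), ∑ j ∈ T, L u j =
      ∑ j ∈ T \ J, L u j + ∑ i, (if (g i : ι) ∈ T then 1 else 0) * f i u := by
    intro T u
    rw [← Finset.sum_inter_add_sum_sdiff T J, add_comm, Finset.inter_comm,
      ← Finset.filter_mem_eq_inter, Finset.sum_filter, hJ, Finset.sum_map]
    congr 1
    refine Finset.sum_congr rfl fun i _ => ?_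
    rw [show f i u = L u (g i) from (congrFun (hg i) u).symm, ite_mul, one_mul, zero_mul]
    rfl
  have hle : (H.powerset.filter (fun T => ∀ u, ∑ j ∈ T, L u j = 0)).card ≤
      (H \ J).powerset.card := by
    refine Finset.card_le_card_of_injOn (fun T => T \ J) ?_ ?_
    · intro T hT
      exact Finset.mem_coe.2 (Finset.mem_powerset.2 (Finset.sdiff_subset_sdiff
        (Finset.mem_powerset.1 (Finset.mem_filter.1 hT).1) subset_rfl))
    · intro T hT T' hT' h
      have h0 := (Finset.mem_filter.1 hT).2
      have h0' := (Finset.mem_filter.1 hT').2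
      have hz : ∑ i, ((if (g i : ι) ∈ T then (1 : ℂ) else 0) -
          (if (g i : ι) ∈ T' then 1 else 0)) • f i = 0 := by
        funext u
        have e := h0 u
        have e' := h0' u
        rw [hsplit] at e e'
        simp only at h
        rw [h] at e
        simp only [Finset.sum_apply, Pi.smul_apply, smul_eq_mul, sub_mul, Finset.sum_sub_distrib,
          Pi.zero_apply]
        linear_combination e - e'
      have hi := Fintype.linearIndependent_iff.1 hli _ hz
      ext x
      by_cases hx : x ∈ J
      · obtain ⟨i, -, rfl⟩ := Finset.mem_map.1 hx
        have := hi i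
        by_cases h₁ : (g i : ι) ∈ T <;> by_cases h₂ : (g i : ι) ∈ T' <;> simp [h₁, h₂] at this ⊢
      · have := congrArg (x ∈ ·) h
        simpa [hx] using this
  rw [Finset.card_powerset] at hle
  calc _ ≤ 2 ^ (H \ J).card * 2 ^ Fintype.card U := by gcongr
    _ = _ := by rw [← pow_add, ← hJcard, Finset.card_sdiff_add_card_eq_card hJH]

section Spectrum

variable {n : ℕ}

/-- The sum of the values of the character `ψ` at `a * j` and `-(a * j)`. -/
def pairSum (ψ : AddChar (ZMod n) ℂ) (a j : ZMod n) : ℂ := ψ (a * j) + ψ (-(a * j))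

theorem pairSum_neg (ψ : AddChar (ZMod n) ℂ) (a j : ZMod n) :
    pairSum ψ a (-j) = pairSum ψ a j := by
  simp [pairSum, add_comm]

variable [NeZero n]

/-- Representatives of the nonzero elements of `ZMod n` up to sign. -/
def halfSet (n : ℕ) [NeZero n] : Finset (ZMod n) :=
  Finset.univ.filter fun j => j ≠ 0 ∧ 2 * j.val ≤ n

theorem card_halfSet : (halfSet n).card = n / 2 := by
  have h : (halfSet n).card = (Finset.Icc 1 (n / 2)).card := by
    refine Finset.card_bij (fun j _ => j.val) ?_ (fun _ _ _ _ h => ZMod.val_injective n h) ?_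
    · intro j hj
      simp only [halfSet, Finset.mem_filter, Finset.mem_univ, true_and] at hj
      have := (ZMod.val_ne_zero j).2 hj.1
      rw [Finset.mem_Icc]
      omega
    · intro k hk
      rw [Finset.mem_Icc] at hk
      have hkn : k < n := by omega
      have hv := ZMod.val_cast_of_lt hkn
      refine ⟨k, ?_, hv⟩
      simp only [halfSet, Finset.mem_filter, Finset.mem_univ, true_and, hv]
      refine ⟨fun h => ?_, by omega⟩
      rw [h, ZMod.val_zero] at hv
      omega
  rw [h, Nat.card_Icc, Nat.add_sub_cancel]

theorem mem_halfSet_or_neg_mem {j : ZMod n} (hj : j ≠ 0) : j ∈ halfSet n ∨ -j ∈ halfSet n := by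
  have h := ZMod.neg_val j
  have := ZMod.val_lt j
  rw [if_neg hj] at h
  simp only [halfSet, Finset.mem_filter, Finset.mem_univ, true_and, neg_ne_zero, h]
  by_cases h2 : 2 * j.val ≤ n
  · exact Or.inl ⟨hj, h2⟩
  · exact Or.inr ⟨hj, by omega⟩

theorem neg_eq_self_of_mem_halfSet {j : ZMod n} (h₁ : j ∈ halfSet n) (h₂ : -j ∈ halfSet n) :
    -j = j := by
  have h := ZMod.neg_val j
  simp only [halfSet, Finset.mem_filter, Finset.mem_univ, true_and] at h₁ h₂
  rw [if_neg h₁.1] at h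
  have := ZMod.val_lt j
  apply ZMod.val_injective n
  omega

theorem mem_halfSet_of_neg_eq_self {j : ZMod n} (hj : j ≠ 0) (h : -j = j) : j ∈ halfSet n := by
  rcases mem_halfSet_or_neg_mem hj with h' | h'
  · exact h'
  · rwa [h] at h'

theorem eq_of_neg_eq_self {i j : ZMod n} (hi : i ≠ 0) (hj : j ≠ 0) (hi' : -i = i)
    (hj' : -j = j) : i = j := by
  have h₁ := ZMod.neg_val i
  have h₂ := ZMod.neg_val j
  rw [if_neg hi, hi'] at h₁
  rw [if_neg hj, hj'] at h₂
  have := ZMod.val_lt i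
  have := ZMod.val_lt j
  apply ZMod.val_injective n
  omega

theorem sum_eq_sum_halfSet (S : Finset (ZMod n)) (h0 : (0 : ZMod n) ∉ S)
    (hS : ∀ x, x ∈ S ↔ -x ∈ S) (f : ZMod n → ℂ) (hf : ∀ j, f (-j) = f j) :
    ∑ j ∈ S, f j = ∑ j ∈ S ∩ halfSet n, (if -j = j then 1 else 2) * f j := by
  have hneg : ∑ j ∈ S \ halfSet n, f j =
      ∑ j ∈ (S ∩ halfSet n).filter (fun j => ¬ -j = j), f j := by
    refine Finset.sum_bij (fun j _ => -j) ?_ (fun _ _ _ _ h => neg_injective h) ?_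
      (fun j _ => (hf j).symm)
    · intro j hj
      rw [Finset.mem_sdiff] at hj
      have hj0 : j ≠ 0 := fun h => h0 (h ▸ hj.1)
      rw [Finset.mem_filter, Finset.mem_inter, neg_neg]
      refine ⟨⟨(hS j).1 hj.1, (mem_halfSet_or_neg_mem hj0).resolve_left hj.2⟩, fun h => ?_⟩
      exact hj.2 (mem_halfSet_of_neg_eq_self hj0 h.symm)
    · intro j hj
      rw [Finset.mem_filter, Finset.mem_inter] at hj
      refine ⟨-j, ?_, neg_neg j⟩
      rw [Finset.mem_sdiff]
      exact ⟨(hS j).1 hj.1.1, fun h => hj.2 (neg_eq_self_of_mem_halfSet hj.1.2 h)⟩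
  rw [← Finset.sum_inter_add_sum_sdiff S (halfSet n), hneg, Finset.sum_filter,
    ← Finset.sum_add_distrib]
  refine Finset.sum_congr rfl fun j _ => ?_
  split_ifs <;> ring

/-- The contribution of `{j, -j}` to the difference of the eigenvalues indexed by `a` and `b`. -/
noncomputable def halfDiff (ψ : AddChar (ZMod n) ℂ) (a b j : ZMod n) : ℂ :=
  (if -j = j then 1 / 2 else 1) * (pairSum ψ a j - pairSum ψ b j)

theorem sum_char_sub_sum_char (ψ : AddChar (ZMod n) ℂ) (S : Finset (ZMod n))
    (h0 : (0 : ZMod n) ∉ S) (hS : ∀ x, x ∈ S ↔ -x ∈ S) (a b : ZMod n) :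
    ∑ j ∈ S, ψ (a * j) - ∑ j ∈ S, ψ (b * j) = ∑ j ∈ S ∩ halfSet n, halfDiff ψ a b j := by
  have hhalf : ∀ c : ZMod n, ∑ j ∈ S, ψ (c * j) = ∑ j ∈ S, pairSum ψ c j / 2 := by
    intro c
    have h : ∑ j ∈ S, ψ (c * j) = ∑ j ∈ S, ψ (-(c * j)) :=
      Finset.sum_bij (fun j _ => -j) (fun j hj => (hS j).1 hj) (fun _ _ _ _ h => neg_injective h)
        (fun j hj => ⟨-j, (hS j).1 hj, neg_neg j⟩) (fun j _ => by simp)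
    rw [← Finset.sum_div]
    simp only [pairSum, Finset.sum_add_distrib]
    rw [← h]
    ring
  rw [hhalf, hhalf, ← Finset.sum_sub_distrib, sum_eq_sum_halfSet S h0 hS _
    (fun j => by simp [pairSum_neg])]
  refine Finset.sum_congr rfl fun j _ => ?_
  rw [halfDiff]
  split_ifs <;> ring

theorem sum_pairSum_mul (ψ : AddChar (ZMod n) ℂ) (hψ : ψ.IsPrimitive) (a c : ZMod n) :
    ∑ j, pairSum ψ a j * ψ (-(c * j)) =
      (if a = c then (n : ℂ) else 0) + (if a = -c then (n : ℂ) else 0) := by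
  have h₁ := AddChar.sum_mulShift (a - c) hψ
  have h₂ := AddChar.sum_mulShift (-(a + c)) hψ
  simp only [neg_eq_zero, sub_eq_zero, add_eq_zero_iff_eq_neg, ZMod.card, Nat.cast_ite,
    Nat.cast_zero] at h₁ h₂
  rw [← h₁, ← h₂, ← Finset.sum_add_distrib]
  refine Finset.sum_congr rfl fun j _ => ?_
  rw [pairSum, add_mul, ← AddChar.map_add_eq_mul, ← AddChar.map_add_eq_mul]
  congr 2 <;> ring

theorem eq_zero_of_sum_halfDiff_eq_zero (ψ : AddChar (ZMod n) ℂ) (hψ : ψ.IsPrimitive)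
    {U : Type*} [Fintype U] (c d : U → ZMod n)
    (hcc : ∀ u v, u ≠ v → c u ≠ c v ∧ c u ≠ -c v) (hcd : ∀ u v, d u ≠ c v ∧ d u ≠ -c v)
    (θ : U → ℂ) (hθ : ∀ j ∈ halfSet n, ∑ u, θ u * halfDiff ψ (c u) (d u) j = 0) : θ = 0 := by
  classical
  have hhalf : ∀ j ∈ halfSet n, ∑ u, θ u * (pairSum ψ (c u) j - pairSum ψ (d u) j) = 0 := by
    intro j hj
    have h := hθ j hj
    simp only [halfDiff, mul_left_comm (θ _), ← Finset.mul_sum] at h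
    refine (mul_eq_zero.1 h).resolve_left ?_
    split_ifs <;> norm_num
  have hall : ∀ j, ∑ u, θ u * (pairSum ψ (c u) j - pairSum ψ (d u) j) = 0 := by
    intro j
    by_cases hj : j = 0
    · simp [hj, pairSum]
    · rcases mem_halfSet_or_neg_mem hj with h | h
      · exact hhalf j h
      · simpa only [pairSum_neg] using hhalf _ h
  funext v
  have hsum : ∑ j, (∑ u, θ u * (pairSum ψ (c u) j - pairSum ψ (d u) j)) * ψ (-(c v * j)) = 0 := by
    simp [hall]
  simp only [Finset.sum_mul] at hsum
  rw [Finset.sum_comm] at hsum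
  simp only [mul_assoc, sub_mul, ← Finset.mul_sum, Finset.sum_sub_distrib,
    sum_pairSum_mul ψ hψ, (hcd _ v).1, (hcd _ v).2, if_false, add_zero, sub_zero] at hsum
  rw [Finset.sum_eq_single v (fun u _ huv => by simp [hcc u v huv]) (by simp)] at hsum
  have hn : (n : ℂ) ≠ 0 := Nat.cast_ne_zero.2 (NeZero.ne n)
  refine (mul_eq_zero.1 hsum).resolve_right ?_
  rw [if_pos rfl]
  split_ifs
  · rw [← two_mul]
    exact mul_ne_zero two_ne_zero hn
  · simpa using hn

theorem isPrimitiveRoot_char_one (ψ : AddChar (ZMod n) ℂ) (hψ : ψ.IsPrimitive) :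
    IsPrimitiveRoot (ψ 1) n := by
  have hpow : ∀ k : ℕ, ψ 1 ^ k = ψ k := fun k => by
    rw [← AddChar.map_nsmul_eq_pow, nsmul_one]
  refine ⟨by simp [hpow], fun k hk => ?_⟩
  rw [hpow, hψ.zmod_char_eq_one_iff] at hk
  exact (ZMod.natCast_eq_zero_iff k n).1 hk

theorem aeval_char_unit_eq_zero (ψ : AddChar (ZMod n) ℂ) (hψ : ψ.IsPrimitive) (u : (ZMod n)ˣ)
    (P : Polynomial ℤ) (hP : Polynomial.aeval (ψ 1) P = 0) :
    Polynomial.aeval (ψ (u : ZMod n)) P = 0 := by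
  have hprim := isPrimitiveRoot_char_one ψ hψ
  have hu : ψ (u : ZMod n) = ψ 1 ^ (u : ZMod n).val := by
    rw [← AddChar.map_nsmul_eq_pow, nsmul_one, ZMod.natCast_zmod_val]
  have hdvd := minpoly.isIntegrallyClosed_dvd (hprim.isIntegral (NeZero.pos n)) hP
  rw [hprim.minpoly_eq_pow_coprime (ZMod.val_coe_unit_coprime u), ← hu] at hdvd
  exact Polynomial.aeval_eq_zero_of_dvd_aeval_eq_zero hdvd (minpoly.aeval _ _)

theorem sum_halfDiff_unit_mul (ψ : AddChar (ZMod n) ℂ) (hψ : ψ.IsPrimitive) (u : (ZMod n)ˣ)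
    (a b : ZMod n) (T : Finset (ZMod n)) (hT : ∑ j ∈ T, halfDiff ψ a b j = 0) :
    ∑ j ∈ T, halfDiff ψ (u * a) (u * b) j = 0 := by
  set P : Polynomial ℤ := ∑ j ∈ T, (if -j = j then 1 else 2) *
    ((Polynomial.X ^ (a * j).val + Polynomial.X ^ (-(a * j)).val) -
      (Polynomial.X ^ (b * j).val + Polynomial.X ^ (-(b * j)).val)) with hPdef
  have hP : ∀ v : ZMod n,
      Polynomial.aeval (ψ v) P = 2 * ∑ j ∈ T, halfDiff ψ (v * a) (v * b) j := by
    intro v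
    have hv : ∀ x : ZMod n, ψ v ^ x.val = ψ (v * x) := fun x => by
      rw [← AddChar.map_nsmul_eq_pow, nsmul_eq_mul, ZMod.natCast_zmod_val, mul_comm]
    rw [hPdef, map_sum, Finset.mul_sum]
    refine Finset.sum_congr rfl fun j _ => ?_
    rw [map_mul, map_sub, map_add, map_add]
    simp only [map_pow, Polynomial.aeval_X, hv, halfDiff, pairSum, mul_neg, mul_assoc]
    split_ifs
    · simp
    · rw [one_mul, map_ofNat]
  have h1 : Polynomial.aeval (ψ 1) P = 0 := by rw [hP]; simp [hT]
  have h2 := aeval_char_unit_eq_zero ψ hψ u P h1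
  rw [hP] at h2
  exact (mul_eq_zero.1 h2).resolve_left two_ne_zero

/-- The subsets of `halfSet n` whose Cayley graph has equal eigenvalues at `a` and `b`. -/
noncomputable def coincidences (ψ : AddChar (ZMod n) ℂ) (a b : ZMod n) :
    Finset (Finset (ZMod n)) :=
  (halfSet n).powerset.filter fun T => ∑ j ∈ T, halfDiff ψ a b j = 0

theorem coincidences_comm (ψ : AddChar (ZMod n) ℂ) (a b : ZMod n) :
    coincidences ψ a b = coincidences ψ b a := by
  refine Finset.filter_congr fun T _ => ?_
  rw [← neg_eq_zero, ← Finset.sum_neg_distrib]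
  refine Eq.congr (Finset.sum_congr rfl fun j _ => ?_) rfl
  rw [halfDiff, halfDiff]
  ring

theorem unitsMap_eq_of_mul_eq {a : ZMod n} (h : addOrderOf a ∣ n) {x y : (ZMod n)ˣ}
    (hxy : (x : ZMod n) * a = y * a) : ZMod.unitsMap h x = ZMod.unitsMap h y := by
  have hv : ∀ z : ZMod n, z.val • a = z * a := fun z => by
    rw [nsmul_eq_mul, ZMod.natCast_zmod_val]
  rw [← hv, ← hv, nsmul_eq_nsmul_iff_modEq, ← ZMod.natCast_eq_natCast_iff] at hxy
  ext
  rw [ZMod.unitsMap_val, ZMod.unitsMap_val, ← ZMod.natCast_val, ← ZMod.natCast_val]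
  exact hxy

theorem card_coincidences_mul_two_pow_le (ψ : AddChar (ZMod n) ℂ) (hψ : ψ.IsPrimitive)
    (a b : ZMod n) (hab : a ≠ b) (hab' : a ≠ -b) :
    ∃ D : ℕ, (addOrderOf a).totient ≤ 6 * D ∧ (coincidences ψ a b).card * 2 ^ D ≤ 2 ^ (n / 2) := by
  classical
  have hm : addOrderOf a ∣ n := by simpa using addOrderOf_dvd_card (x := a)
  have : NeZero (addOrderOf a) := ⟨(addOrderOf_pos a).ne'⟩
  choose x hx using ZMod.unitsMap_surjective hm
  set c : (ZMod (addOrderOf a))ˣ → ZMod n := fun w => x w * a with hc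
  set d : (ZMod (addOrderOf a))ˣ → ZMod n := fun w => x w * b with hd
  have hcinj : ∀ w w', c w = c w' → w = w' := fun w w' h => by
    rw [← hx w, ← hx w', unitsMap_eq_of_mul_eq hm h]
  have hdinj : ∀ s : ZMod n, s * s = 1 → ∀ w v v',
      d v = s * c w → d v' = s * c w → v = v' := by
    intro s hs w v v' h h'
    simp only [hc, hd] at h h'
    have e : (x w : ZMod n) * (x v * a) = x w * (x v' * a) := by
      linear_combination (s * x v') * h - (s * x v) * h' - (x w * x v * a - x w * x v' * a) * hs
    exact hcinj v v' ((x w).isUnit.mul_left_cancel e)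
  set R : (ZMod (addOrderOf a))ˣ → (ZMod (addOrderOf a))ˣ → Prop := fun w w' =>
    c w' = c w ∨ c w' = -c w ∨ c w' = d w ∨ c w' = -d w ∨ d w' = c w ∨ d w' = -c w with hR
  obtain ⟨U, hU, hcard⟩ := exists_independent_card_le R (fun w => Or.inl rfl) (by
    intro w w' h
    simp only [hR] at h ⊢
    rcases h with h | h | h | h | h | h <;> simp [h]) 6 (by
    intro w
    have hone : ∀ (p : (ZMod (addOrderOf a))ˣ → Prop) [DecidablePred p],
        (∀ v v', p v → p v' → v = v') →
        (Finset.univ.filter p).card ≤ 1 := fun p _ hp => Finset.card_le_one.2 fun v hv v' hv' =>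
      hp v v' (Finset.mem_filter.1 hv).2 (Finset.mem_filter.1 hv').2
    have hceq : ∀ y, (Finset.univ.filter fun w' => c w' = y).card ≤ 1 := fun y =>
      hone _ fun v v' (h : c v = y) (h' : c v' = y) => hcinj v v' (h.trans h'.symm)
    have hdeq : (Finset.univ.filter fun w' => d w' = c w).card ≤ 1 :=
      hone _ fun v v' (h : d v = c w) (h' : d v' = c w) =>
        hdinj 1 (by ring) w v v' (by rw [h, one_mul]) (by rw [h', one_mul])
    have hdneg : (Finset.univ.filter fun w' => d w' = -c w).card ≤ 1 :=
      hone _ fun v v' (h : d v = -c w) (h' : d v' = -c w) =>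
        hdinj (-1) (by ring) w v v' (by rw [h]; ring) (by rw [h']; ring)
    simp only [hR, Finset.filter_or]
    refine (Finset.card_union_le _ _).trans (Nat.add_le_add (hceq _) (?_ : _ ≤ 5))
    refine (Finset.card_union_le _ _).trans (Nat.add_le_add (hceq _) (?_ : _ ≤ 4))
    refine (Finset.card_union_le _ _).trans (Nat.add_le_add (hceq _) (?_ : _ ≤ 3))
    refine (Finset.card_union_le _ _).trans (Nat.add_le_add (hceq _) (?_ : _ ≤ 2))
    exact (Finset.card_union_le _ _).trans (Nat.add_le_add hdeq hdneg))
  refine ⟨U.card, by rwa [ZMod.card_units_eq_totient] at hcard, ?_⟩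
  have hcount := card_common_zero_sum_mul_le (halfSet n)
    (fun (u : U) j => halfDiff ψ (c u) (d u) j) (eq_zero_of_sum_halfDiff_eq_zero ψ hψ _ _ ?_ ?_)
  · rw [card_halfSet, Fintype.card_coe] at hcount
    refine le_trans (Nat.mul_le_mul_right _ (Finset.card_le_card ?_)) hcount
    intro T hT
    rw [coincidences, Finset.mem_filter] at hT
    rw [Finset.mem_filter]
    exact ⟨hT.1, fun u => sum_halfDiff_unit_mul ψ hψ _ a b T hT.2⟩
  · intro u v huv
    constructor <;> intro h
    · exact huv (Subtype.ext (hU u u.2 v v.2 (by simp [hR, h])))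
    · exact huv (Subtype.ext (hU u u.2 v v.2 (by simp [hR, h])))
  · have key : ∀ u v : U, d u = c v ∨ d u = -c v → False := by
      intro u v h
      have huv : (u : (ZMod (addOrderOf a))ˣ) = v := hU u u.2 v v.2 (by
        rcases h with h | h <;> simp [hR, h])
      rw [huv] at h
      simp only [hc, hd, ← mul_neg] at h
      rcases h with h | h
      · exact hab ((x v).isUnit.mul_left_cancel h).symm
      · have := (x v).isUnit.mul_left_cancel h
        exact hab' (by rw [this, neg_neg])
    exact fun u v => ⟨fun h => key u v (Or.inl h), fun h => key u v (Or.inr h)⟩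

theorem card_coincidences_sq_mul_le (ψ : AddChar (ZMod n) ℂ) (hψ : ψ.IsPrimitive)
    (a b : ZMod n) (hab : a ≠ b) (hab' : a ≠ -b) :
    (coincidences ψ a b).card ^ 2 * n ≤ 2 * (addOrderOf a * addOrderOf b) * 4 ^ (n / 2) := by
  classical
  obtain ⟨j₀, hj₀⟩ : ∃ j, pairSum ψ a j - pairSum ψ b j ≠ 0 := by
    by_contra! h
    have h1 := eq_zero_of_sum_halfDiff_eq_zero ψ hψ (fun _ : Unit => a) (fun _ => b)
      (fun u v huv => absurd (Subsingleton.elim u v) huv)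
      (fun _ _ => ⟨hab.symm, fun h => hab' (by rw [h, neg_neg])⟩) 1
      (fun j _ => by simp [halfDiff, h])
    exact one_ne_zero (congrFun h1 ())
  set C := (halfSet n).filter fun j => ¬ -j = j ∧
    pairSum ψ a j - pairSum ψ b j = pairSum ψ a j₀ - pairSum ψ b j₀ with hC
  have hbound := card_zero_sum_sq_mul_le (halfSet n) C (Finset.filter_subset _ _)
    (halfDiff ψ a b) _ hj₀ (by
      intro j hj
      obtain ⟨-, h₁, h₂⟩ := Finset.mem_filter.1 hj
      rw [halfDiff, if_neg h₁, one_mul, h₂])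
  rw [card_halfSet] at hbound
  set f := AddMonoidHom.mulLeft a
  set g := AddMonoidHom.mulLeft b
  have hindex : ∀ c : ZMod n, (AddMonoidHom.mulLeft c).ker.index ≤ addOrderOf c := by
    intro c
    rw [AddSubgroup.index_ker, ← Nat.card_zmultiples]
    refine Nat.card_mono (Set.toFinite _) ?_
    rintro _ ⟨j, rfl⟩
    refine ⟨j.val, ?_⟩
    simp [mul_comm]
  have hK := AddSubgroup.card_mul_index (f.ker ⊓ g.ker)
  rw [Nat.card_zmod] at hK
  have hKC : Nat.card (f.ker ⊓ g.ker : AddSubgroup (ZMod n)) ≤ 2 * C.card + 1 := by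
    set Z := Finset.univ.filter fun j : ZMod n => j ≠ 0 ∧ -j = j
    have hZ : Z.card ≤ 1 := Finset.card_le_one.2 fun i hi j hj => by
      simp only [Z, Finset.mem_filter, Finset.mem_univ, true_and] at hi hj
      exact eq_of_neg_eq_self hi.1 hj.1 hi.2 hj.2
    have hsub : ∀ k ∈ f.ker ⊓ g.ker, j₀ + k ∈ C ∪ C.image Neg.neg ∪ Z := by
      rintro k ⟨hk₁, hk₂⟩
      have hk₁ : a * k = 0 := hk₁
      have hk₂ : b * k = 0 := hk₂
      have hval : pairSum ψ a (j₀ + k) - pairSum ψ b (j₀ + k) =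
          pairSum ψ a j₀ - pairSum ψ b j₀ := by
        simp [pairSum, mul_add, hk₁, hk₂]
      have hne : j₀ + k ≠ 0 := by
        intro h
        rw [h] at hval
        exact hj₀ (by rw [← hval]; simp [pairSum])
      simp only [Finset.mem_union, Finset.mem_image, Finset.mem_filter, Z, C, Finset.mem_univ,
        true_and]
      by_cases hself : -(j₀ + k) = j₀ + k
      · exact Or.inr ⟨hne, hself⟩
      · left
        rcases mem_halfSet_or_neg_mem hne with h | h
        · exact Or.inl ⟨h, hself, hval⟩
        · refine Or.inr ⟨-(j₀ + k), ⟨h, ?_, ?_⟩, neg_neg _⟩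
          · rw [neg_neg]
            exact fun h => hself h.symm
          · rw [pairSum_neg, pairSum_neg, hval]
    calc Nat.card (f.ker ⊓ g.ker : AddSubgroup (ZMod n))
        ≤ Nat.card (C ∪ C.image Neg.neg ∪ Z : Finset (ZMod n)) :=
          Nat.card_le_card_of_injective (fun k => ⟨j₀ + k.1, hsub k.1 k.2⟩) (fun k k' h =>
            Subtype.ext (add_left_cancel (congrArg Subtype.val h)))
      _ = (C ∪ C.image Neg.neg ∪ Z).card := Nat.card_eq_fintype_card.trans (Fintype.card_coe _)
      _ ≤ C.card + C.card + 1 := by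
          refine (Finset.card_union_le _ _).trans (add_le_add ?_ hZ)
          exact (Finset.card_union_le _ _).trans (add_le_add le_rfl Finset.card_image_le)
      _ = _ := by ring
  have hn : n ≤ (2 * (C.card + 1)) * (addOrderOf a * addOrderOf b) := by
    calc n = _ := hK.symm
      _ ≤ _ := Nat.mul_le_mul (by omega)
        (AddSubgroup.index_inf_le.trans (Nat.mul_le_mul (hindex a) (hindex b)))
  calc (coincidences ψ a b).card ^ 2 * n
      ≤ (coincidences ψ a b).card ^ 2 * ((2 * (C.card + 1)) * (addOrderOf a * addOrderOf b)) := by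
        gcongr
    _ = 2 * (addOrderOf a * addOrderOf b) * ((coincidences ψ a b).card ^ 2 * (C.card + 1)) := by
        ring
    _ ≤ _ := Nat.mul_le_mul_left _ hbound

theorem exists_eq_of_ncard_range_lt {β : Type*} (F : ZMod n → β)
    (hF : (Set.range F).ncard < (n + 2) / 2) : ∃ a b, a ≠ b ∧ a ≠ -b ∧ F a = F b := by
  classical
  by_contra! h
  have hinj : Set.InjOn F (insert 0 (halfSet n) : Finset (ZMod n)) := by
    intro i hi j hj hij
    by_contra hne
    by_cases hneg : i = -j
    · have hj0 : j ≠ 0 := fun h0 => hne (by rw [hneg, h0, neg_zero])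
      have hi0 : i ≠ 0 := fun h0 => hj0 (by rw [← neg_eq_zero, ← hneg, h0])
      rw [Finset.mem_coe, Finset.mem_insert] at hi hj
      have hi' := hi.resolve_left hi0
      rw [hneg] at hi'
      exact hne (hneg.trans (neg_eq_self_of_mem_halfSet (hj.resolve_left hj0) hi'))
    · exact h i j hne hneg hij
  have hcard : (insert 0 (halfSet n) : Finset (ZMod n)).card = n / 2 + 1 := by
    rw [Finset.card_insert_of_notMem (by simp [halfSet]), card_halfSet]
  have hle : n / 2 + 1 ≤ (Set.range F).ncard := by
    rw [← hcard, ← Set.ncard_coe_finset, ← hinj.ncard_image]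
    exact Set.ncard_le_ncard (Set.image_subset_range _ _) (Set.finite_range F)
  omega

theorem ncard_unsaturated_le (ψ : AddChar (ZMod n) ℂ) (hψ : ∀ x, ψ x = zetaC n ^ x.val) :
    {S : Finset (ZMod n) | (0 : ZMod n) ∉ S ∧ (∀ x : ZMod n, x ∈ S ↔ -x ∈ S) ∧
      (Set.range (cayEig n S)).ncard < (n + 2) / 2}.ncard ≤
    ∑ p : ZMod n × ZMod n with p.1 ≠ p.2 ∧ p.1 ≠ -p.2, (coincidences ψ p.1 p.2).card := by
  classical
  refine le_trans ?_ Finset.card_biUnion_le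
  rw [← Set.ncard_coe_finset]
  refine Set.ncard_le_ncard_of_injOn (fun S => S ∩ halfSet n) ?_ ?_ (Finset.finite_toSet _)
  · rintro S ⟨h0, hS, hlt⟩
    obtain ⟨a, b, hab, hab', h⟩ := exists_eq_of_ncard_range_lt _ hlt
    simp only [cayEig, ← hψ] at h
    rw [← sub_eq_zero, sum_char_sub_sum_char ψ S h0 hS] at h
    simp only [Finset.coe_biUnion, Set.mem_iUnion, Finset.mem_coe]
    refine ⟨(a, b), by simp [hab, hab'], ?_⟩
    rw [coincidences, Finset.mem_filter, Finset.mem_powerset]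
    exact ⟨Finset.inter_subset_right, h⟩
  · rintro S ⟨h0, hS, -⟩ S' ⟨h0', hS', -⟩ h
    have hmem : ∀ j ∈ halfSet n, j ∈ S ↔ j ∈ S' := fun j hj => by
      have := congrArg (j ∈ ·) h
      simpa [hj] using this
    ext j
    by_cases hj : j = 0
    · simp [hj, h0, h0']
    · rcases mem_halfSet_or_neg_mem hj with h | h
      · exact hmem j h
      · rw [hS j, hS' j, hmem _ h]

theorem card_addOrderOf_le_le (M : ℕ) :
    (Finset.univ.filter fun a : ZMod n => addOrderOf a ≤ M).card ≤ M ^ 2 := by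
  classical
  have hsub : (Finset.univ.filter fun a : ZMod n => addOrderOf a ≤ M) ⊆
      (Finset.Icc 1 M).biUnion fun d => Finset.univ.filter fun a : ZMod n => d • a = 0 := by
    intro a ha
    rw [Finset.mem_filter] at ha
    rw [Finset.mem_biUnion]
    exact ⟨addOrderOf a, Finset.mem_Icc.2 ⟨addOrderOf_pos a, ha.2⟩,
      Finset.mem_filter.2 ⟨Finset.mem_univ _, addOrderOf_nsmul_eq_zero a⟩⟩
  refine (Finset.card_le_card hsub).trans ?_
  refine (Finset.card_biUnion_le_card_mul _ _ M fun d hd => ?_).trans (by simp [sq])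
  rw [Finset.mem_Icc] at hd
  exact (IsAddCyclic.card_nsmul_eq_zero_le (by omega)).trans hd.2

theorem card_coincidences_le_of_addOrderOf_le (ψ : AddChar (ZMod n) ℂ) (hψ : ψ.IsPrimitive)
    (a b : ZMod n) (hab : a ≠ b) (hab' : a ≠ -b) (x : ℝ) (ha : (addOrderOf a : ℝ) ≤ x)
    (hb : (addOrderOf b : ℝ) ≤ x) :
    ((coincidences ψ a b).card : ℝ) ≤ 2 ^ (n / 2) * (2 * x * (n : ℝ) ^ (-(1 / 2 : ℝ))) := by
  have hx : 0 ≤ x := (Nat.cast_nonneg _).trans ha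
  have hn : (0 : ℝ) < n := Nat.cast_pos.2 (NeZero.pos n)
  have h : ((coincidences ψ a b).card : ℝ) ^ 2 * n ≤
      2 * (addOrderOf a * addOrderOf b) * 4 ^ (n / 2) := by
    exact_mod_cast card_coincidences_sq_mul_le ψ hψ a b hab hab'
  refine (sq_le_sq₀ (by positivity) (by positivity)).1 ?_
  have hsq : ((n : ℝ) ^ (-(1 / 2 : ℝ))) ^ 2 = (n : ℝ)⁻¹ := by
    rw [← Real.rpow_natCast, ← Real.rpow_mul hn.le, ← Real.rpow_neg_one]
    norm_num
  rw [mul_pow, mul_pow, hsq, ← mul_assoc, ← div_eq_mul_inv, le_div_iff₀ hn, ← pow_mul,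
    mul_comm (n / 2), pow_mul]
  calc _ ≤ 2 * ((addOrderOf a : ℝ) * addOrderOf b) * 4 ^ (n / 2) := h
    _ ≤ 2 * (x * x) * 4 ^ (n / 2) := by gcongr
    _ ≤ (2 ^ 2) ^ (n / 2) * (2 * x) ^ 2 := by
      have : (0 : ℝ) ≤ 4 ^ (n / 2) * x ^ 2 := by positivity
      norm_num
      nlinarith

theorem card_coincidences_le_of_lt_addOrderOf (ψ : AddChar (ZMod n) ℂ) (hψ : ψ.IsPrimitive)
    (a b : ZMod n) (hab : a ≠ b) (hab' : a ≠ -b) (x : ℝ) (ha : x < addOrderOf a) :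
    ((coincidences ψ a b).card : ℝ) ≤ 2 ^ (n / 2) * (2 : ℝ) ^ (-(√x / 9)) := by
  obtain ⟨D, hD, h⟩ := card_coincidences_mul_two_pow_le ψ hψ a b hab hab'
  have hx : √x ≤ 9 * D := by
    refine Real.sqrt_le_iff.2 ⟨by positivity, ?_⟩
    have h₁ : (addOrderOf a : ℝ) ≤ 2 * (addOrderOf a).totient ^ 2 := by
      exact_mod_cast le_two_mul_totient_sq _
    have h₂ : ((addOrderOf a).totient : ℝ) ≤ 6 * D := by exact_mod_cast hD
    have h₃ : ((addOrderOf a).totient : ℝ) ^ 2 ≤ (6 * D) ^ 2 := by gcongr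
    nlinarith [sq_nonneg (D : ℝ)]
  have h' : ((coincidences ψ a b).card : ℝ) * 2 ^ D ≤ 2 ^ (n / 2) := by exact_mod_cast h
  calc ((coincidences ψ a b).card : ℝ) ≤ 2 ^ (n / 2) * (2 : ℝ) ^ (-(D : ℝ)) := by
        rw [Real.rpow_neg two_pos.le, Real.rpow_natCast, ← div_eq_mul_inv,
          le_div_iff₀ (by positivity)]
        exact h'
    _ ≤ _ := by
        gcongr
        · norm_num
        · linarith

theorem sum_card_coincidences_le (ψ : AddChar (ZMod n) ℂ) (hψ : ψ.IsPrimitive) (x : ℝ)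
    (hx : 0 ≤ x) :
    ((∑ p : ZMod n × ZMod n with p.1 ≠ p.2 ∧ p.1 ≠ -p.2,
      (coincidences ψ p.1 p.2).card : ℕ) : ℝ) ≤
    2 ^ (n / 2) * (2 * x ^ 5 * (n : ℝ) ^ (-(1 / 2 : ℝ)) + n ^ 2 * (2 : ℝ) ^ (-(√x / 9))) := by
  classical
  set A := Finset.univ.filter fun a : ZMod n => addOrderOf a ≤ ⌊x⌋₊
  have hA : (A.card : ℝ) ≤ x ^ 2 := by
    have h : (A.card : ℝ) ≤ (⌊x⌋₊ : ℝ) ^ 2 := by exact_mod_cast card_addOrderOf_le_le ⌊x⌋₊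
    exact h.trans (by gcongr; exact Nat.floor_le hx)
  set s := 2 ^ (n / 2) * (2 * x * (n : ℝ) ^ (-(1 / 2 : ℝ)))
  set t := 2 ^ (n / 2) * (2 : ℝ) ^ (-(√x / 9))
  have hs : 0 ≤ s := by positivity
  have ht : 0 ≤ t := by positivity
  have hmem : ∀ a : ZMod n, a ∈ A ↔ (addOrderOf a : ℝ) ≤ x := fun a => by
    simp [A, Nat.le_floor_iff hx]
  push_cast
  calc _ ≤ ∑ p : ZMod n × ZMod n with p.1 ≠ p.2 ∧ p.1 ≠ -p.2,
        ((if p ∈ A ×ˢ A then s else 0) + t) := by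
        refine Finset.sum_le_sum fun p hp => ?_
        obtain ⟨h₁, h₂⟩ := (Finset.mem_filter.1 hp).2
        by_cases ha : p.1 ∈ A
        · by_cases hb : p.2 ∈ A
          · rw [if_pos (Finset.mem_product.2 ⟨ha, hb⟩)]
            refine le_add_of_le_of_nonneg ?_ ht
            exact card_coincidences_le_of_addOrderOf_le ψ hψ _ _ h₁ h₂ x ((hmem _).1 ha)
              ((hmem _).1 hb)
          · refine le_add_of_nonneg_of_le (by split_ifs <;> simp [hs]) ?_
            rw [hmem, not_le] at hb
            rw [coincidences_comm]
            exact card_coincidences_le_of_lt_addOrderOf ψ hψ _ _ h₁.symm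
              (fun h => h₂ (by rw [h, neg_neg])) x hb
        · refine le_add_of_nonneg_of_le (by split_ifs <;> simp [hs]) ?_
          rw [hmem, not_le] at ha
          exact card_coincidences_le_of_lt_addOrderOf ψ hψ _ _ h₁ h₂ x ha
    _ ≤ ∑ p : ZMod n × ZMod n, ((if p ∈ A ×ˢ A then s else 0) + t) := by
        refine Finset.sum_le_sum_of_subset_of_nonneg (Finset.filter_subset _ _) fun p _ _ => ?_
        split_ifs <;> positivity
    _ = (A.card * A.card) * s + n ^ 2 * t := by
        rw [Finset.sum_add_distrib, ← Finset.sum_filter, Finset.filter_mem_eq_inter,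
          Finset.univ_inter, Finset.sum_const, Finset.sum_const, Finset.card_product,
          Finset.card_univ, Fintype.card_prod, ZMod.card]
        simp only [nsmul_eq_mul]
        push_cast
        ring
    _ ≤ (x ^ 2 * x ^ 2) * s + n ^ 2 * t := by gcongr
    _ = _ := by ring

end Spectrum

theorem eventually_error_le (ε : ℝ) (hε : 0 < ε) :
    ∀ᶠ n : ℕ in Filter.atTop,
      2 * ((n : ℝ) ^ (ε / 10)) ^ 5 * (n : ℝ) ^ (-(1 / 2 : ℝ)) +
        n ^ 2 * (2 : ℝ) ^ (-(√((n : ℝ) ^ (ε / 10)) / 9)) ≤ (n : ℝ) ^ (-(1 / 2 : ℝ) + ε) := by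
  have hpow : ∀ r : ℝ, 0 < r → Filter.Tendsto (fun n : ℕ => (n : ℝ) ^ r) Filter.atTop
      Filter.atTop := fun r hr => (tendsto_rpow_atTop hr).comp tendsto_natCast_atTop_atTop
  have hdecay := (tendsto_rpow_mul_exp_neg_mul_atTop_nhds_zero (60 / ε) (Real.log 2 / 9)
    (by positivity)).comp (hpow (ε / 20) (by positivity))
  filter_upwards [(hpow (ε / 2) (by positivity)).eventually_ge_atTop 4,
    hdecay.eventually (ge_mem_nhds (show (0 : ℝ) < 1 / 2 by norm_num)),
    Filter.eventually_ge_atTop 1] with n h₁ h₂ hn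
  have hn1 : (1 : ℝ) ≤ n := by exact_mod_cast hn
  have hn0 : (0 : ℝ) < n := by linarith
  have hx5 : ((n : ℝ) ^ (ε / 10)) ^ 5 = (n : ℝ) ^ (ε / 2) := by
    rw [← Real.rpow_natCast, ← Real.rpow_mul hn0.le]
    congr 1
    push_cast
    ring
  have hsqrt : √((n : ℝ) ^ (ε / 10)) = (n : ℝ) ^ (ε / 20) := by
    rw [Real.sqrt_eq_rpow, ← Real.rpow_mul hn0.le]
    congr 1
    ring
  have hε2 : (n : ℝ) ^ ε = (n : ℝ) ^ (ε / 2) * (n : ℝ) ^ (ε / 2) := by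
    rw [← Real.rpow_add hn0]
    congr 1
    ring
  have hcube : ((n : ℝ) ^ (ε / 20)) ^ (60 / ε) = (n : ℝ) ^ 3 := by
    rw [← Real.rpow_mul hn0.le, ← Real.rpow_natCast]
    congr 1
    push_cast
    field_simp
    norm_num
  have hexp : (2 : ℝ) ^ (-((n : ℝ) ^ (ε / 20) / 9)) =
      Real.exp (-(Real.log 2 / 9) * (n : ℝ) ^ (ε / 20)) := by
    rw [Real.rpow_def_of_pos two_pos]
    congr 1
    ring
  simp only [Function.comp_apply, hcube] at h₂
  rw [hx5, hsqrt, hexp, Real.rpow_add hn0]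
  set y := (n : ℝ) ^ (ε / 2)
  set z := (n : ℝ) ^ (-(1 / 2 : ℝ))
  set e := Real.exp (-(Real.log 2 / 9) * (n : ℝ) ^ (ε / 20))
  have hz : 1 ≤ n * z := by
    have : (n : ℝ) * z = (n : ℝ) ^ (1 / 2 : ℝ) := by
      nth_rewrite 1 [← Real.rpow_one (n : ℝ)]
      rw [← Real.rpow_add hn0]
      norm_num
    rw [this]
    exact Real.one_le_rpow hn1 (by norm_num)
  have hz0 : 0 < z := by positivity
  have he0 : 0 < e := Real.exp_pos _
  have hsecond : (n : ℝ) ^ 2 * e ≤ z / 2 := by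
    calc (n : ℝ) ^ 2 * e ≤ (n : ℝ) ^ 2 * e * (n * z) := le_mul_of_one_le_right (by positivity) hz
      _ = (n ^ 3 * e) * z := by ring
      _ ≤ 1 / 2 * z := by gcongr
      _ = _ := by ring
  rw [hε2]
  nlinarith [mul_le_mul_of_nonneg_left h₁ (mul_nonneg hz0.le (by positivity : 0 ≤ y))]

/-- For every `ε > 0` and all sufficiently large `n`, the number of inverse-closed
connection sets `S ⊆ Z_n \ {0}` (i.e. `S = -S`) for which the number of distinct
eigenvalues `|{λ_{a,S} : a ∈ Z_n}|` is smaller than `⌈(n+1)/2⌉ = (n+2)/2` is at most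
`n^{-1/2+ε} · 2^{⌊n/2⌋}`; i.e., a uniformly random inverse-closed `S` gives a Cayley
graph `Cay(Z_n,S)` with saturated spectrum with probability at least
`1 - n^{-1/2+ε}`. -/
theorem stmt6 :
    ∀ ε : ℝ, 0 < ε → ∃ N : ℕ, ∀ n : ℕ, N ≤ n →
      ({S : Finset (ZMod n) | (0 : ZMod n) ∉ S ∧ (∀ x : ZMod n, x ∈ S ↔ -x ∈ S) ∧
          (Set.range (cayEig n S)).ncard < (n + 2) / 2}.ncard : ℝ) ≤
        (n : ℝ) ^ (-(1 / 2 : ℝ) + ε) * 2 ^ (n / 2) := by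
  intro ε hε
  obtain ⟨N, hN⟩ := Filter.eventually_atTop.1 (eventually_error_le ε hε)
  refine ⟨max N 1, fun n hn => ?_⟩
  have : NeZero n := ⟨by have := le_of_max_le_right hn; omega⟩
  have hζ : IsPrimitiveRoot (zetaC n) n := by
    have h : zetaC n = (Complex.exp (2 * Real.pi * Complex.I / n))⁻¹ := by
      rw [zetaC, neg_div, Complex.exp_neg]
    rw [h]
    exact (Complex.isPrimitiveRoot_exp n (NeZero.ne n)).inv
  have hprim := AddChar.zmodChar_primitive_of_primitive_root n hζ
  refine (Nat.cast_le.2 (ncard_unsaturated_le _ (AddChar.zmodChar_apply hζ.pow_eq_one))).trans ?_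
  refine (sum_card_coincidences_le _ hprim ((n : ℝ) ^ (ε / 10)) (by positivity)).trans ?_
  rw [mul_comm]
  exact mul_le_mul_of_nonneg_right (hN n (le_of_max_le_left hn)) (by positivity)
end

section
/- Let n be a positive integer and S, T ⊆ Z_n \ {0}. Suppose the Cayley digraphs Cay(Z_n,S) and Cay(Z_n,T) are isomorphic, i.e., there is a bijection φ : Z_n → Z_n such that for all x, y ∈ Z_n one has y − x ∈ S if and only if φ(y) − φ(x) ∈ T. If k is a unit of the ring Z_n with kS = S, then kT = T. -/
/-- The sum of the additive character `x ↦ exp (2πi a x / n)` over `S`; these are the eigenvalues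
of the Cayley digraph of `ZMod n` with connection set `S`. -/
noncomputable def cayleyEigenvalue {n : ℕ} [NeZero n] (S : Finset (ZMod n)) (a : ZMod n) : ℂ :=
  ∑ s ∈ S, ZMod.stdAddChar (a * s)

section

variable {n : ℕ} [NeZero n] {S T : Finset (ZMod n)}

open scoped ZMod in
theorem dft_indicator_eq_cayleyEigenvalue (T : Finset (ZMod n)) (a : ZMod n) :
    𝓕 (fun x ↦ if x ∈ T then (1 : ℂ) else 0) a = cayleyEigenvalue T (-a) := by
  simp [ZMod.dft_apply, cayleyEigenvalue, mul_comm]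

open scoped ZMod in
/-- Every eigenvalue of a Cayley digraph is an eigenvalue of any isomorphic one. -/
theorem exists_cayleyEigenvalue_eq {φ : ZMod n → ZMod n} (hφ : Function.Bijective φ)
    (hiso : ∀ x y : ZMod n, y - x ∈ S ↔ φ y - φ x ∈ T) (a : ZMod n) :
    ∃ b, cayleyEigenvalue S b = cayleyEigenvalue T a := by
  set f : ZMod n → ℂ := fun x ↦ ZMod.stdAddChar (a * φ x) with hf
  have hf0 : f ≠ 0 := fun h ↦ by
    have h0 := congrFun h 0
    simp [hf, ZMod.stdAddChar_apply] at h0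
  have heig (x : ZMod n) : ∑ s ∈ S, f (x + s) = cayleyEigenvalue T a * f x := by
    rw [cayleyEigenvalue, Finset.sum_mul]
    refine Finset.sum_bij (fun s _ ↦ φ (x + s) - φ x) (fun s hs ↦ ?_) (fun s _ t _ h ↦ ?_)
      (fun t ht ↦ ?_) (fun s _ ↦ ?_)
    · rw [← hiso]
      simpa using hs
    · exact add_left_cancel (hφ.1 (sub_left_injective h))
    · obtain ⟨y, hy⟩ := hφ.2 (t + φ x)
      refine ⟨y - x, ?_, ?_⟩
      · rw [hiso, hy]
        simpa using ht
      · simp [hy]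
    · rw [← AddChar.map_add_eq_mul, ← mul_add, sub_add_cancel]
  obtain ⟨b, hb⟩ : ∃ b, 𝓕 f b ≠ 0 := by
    by_contra! h
    exact hf0 ((LinearEquiv.map_eq_zero_iff ZMod.dft).1 (funext h))
  refine ⟨b, mul_right_cancel₀ hb ?_⟩
  calc cayleyEigenvalue S b * 𝓕 f b
      = ∑ s ∈ S, ∑ y, ZMod.stdAddChar (b * s) * (ZMod.stdAddChar (-(y * b)) * f y) := by
        simp_rw [cayleyEigenvalue, ZMod.dft_apply, Finset.sum_mul, Finset.mul_sum, smul_eq_mul]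
    _ = ∑ s ∈ S, ∑ x, ZMod.stdAddChar (-(x * b)) * f (x + s) := by
        refine Finset.sum_congr rfl fun s _ ↦ ?_
        refine (Fintype.sum_equiv (Equiv.addRight s) _ _ fun x ↦ ?_).symm
        have hx : -(x * b) = b * s + -((x + s) * b) := by ring
        rw [Equiv.coe_addRight, ← mul_assoc, hx, AddChar.map_add_eq_mul]
    _ = cayleyEigenvalue T a * 𝓕 f b := by
        rw [Finset.sum_comm, ZMod.dft_apply, Finset.mul_sum]
        refine Finset.sum_congr rfl fun x _ ↦ ?_
        rw [← Finset.mul_sum, heig, smul_eq_mul]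
        ring

theorem isPrimitiveRoot_stdAddChar_one (n : ℕ) [NeZero n] :
    IsPrimitiveRoot (ZMod.stdAddChar (1 : ZMod n)) n := by
  have h := Complex.isPrimitiveRoot_exp n (NeZero.ne n)
  have h1 := ZMod.stdAddChar_coe (N := n) 1
  simp only [Int.cast_one, mul_one] at h1
  rwa [h1]

/-- An equality of eigenvalues is preserved by the Galois action of the units of `ZMod n`. -/
theorem cayleyEigenvalue_unit_mul_eq (u : (ZMod n)ˣ) {a b : ZMod n}
    (h : cayleyEigenvalue S b = cayleyEigenvalue T a) :
    cayleyEigenvalue S (u * b) = cayleyEigenvalue T (u * a) := by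
  set ζ : ℂ := ZMod.stdAddChar (1 : ZMod n) with hζ
  have hprim : IsPrimitiveRoot ζ n := isPrimitiveRoot_stdAddChar_one n
  have hpow (m : ℕ) : ζ ^ m = ZMod.stdAddChar (m : ZMod n) := by
    rw [hζ, ← AddChar.map_nsmul_eq_pow, nsmul_one]
  let P (S : Finset (ZMod n)) (a : ZMod n) : Polynomial ℤ := ∑ s ∈ S, Polynomial.X ^ (a * s).val
  have hP (S : Finset (ZMod n)) (a : ZMod n) (m : ℕ) :
      Polynomial.aeval (ζ ^ m) (P S a) = cayleyEigenvalue S (m * a) := by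
    simp only [P, cayleyEigenvalue, map_sum, map_pow, Polynomial.aeval_X, ← pow_mul]
    simp only [hpow, Nat.cast_mul, ZMod.natCast_zmod_val, mul_assoc]
  have hroot : Polynomial.aeval ζ (P S b - P T a) = 0 := by
    have hS := hP S b 1
    have hT := hP T a 1
    simp only [pow_one, Nat.cast_one, one_mul] at hS hT
    rw [map_sub, hS, hT, h, sub_self]
  have hdvd := minpoly.isIntegrallyClosed_dvd (hprim.isIntegral (NeZero.pos n)) hroot
  rw [hprim.minpoly_eq_pow_coprime (ZMod.val_coe_unit_coprime u)] at hdvd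
  have hroot' := Polynomial.aeval_eq_zero_of_dvd_aeval_eq_zero hdvd (minpoly.aeval ℤ _)
  rw [map_sub, hP, hP, ZMod.natCast_zmod_val] at hroot'
  exact sub_eq_zero.1 hroot'

theorem cayleyEigenvalue_unit_mul_of_image_eq (u : (ZMod n)ˣ)
    (hS : S.image (fun s ↦ (u : ZMod n) * s) = S) (b : ZMod n) :
    cayleyEigenvalue S (u * b) = cayleyEigenvalue S b := by
  conv_rhs => rw [cayleyEigenvalue, ← hS]
  rw [Finset.sum_image fun x _ y _ h ↦ u.isUnit.mul_left_cancel h, cayleyEigenvalue]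
  refine Finset.sum_congr rfl fun s _ ↦ ?_
  ring_nf

open scoped ZMod in
theorem image_unit_mul_eq_of_cayleyEigenvalue (u : (ZMod n)ˣ)
    (hT : ∀ a, cayleyEigenvalue T (u * a) = cayleyEigenvalue T a) :
    T.image (fun s ↦ (u : ZMod n) * s) = T := by
  have hind : (fun x ↦ if (u : ZMod n) * x ∈ T then (1 : ℂ) else 0) =
      fun x ↦ if x ∈ T then (1 : ℂ) else 0 := by
    refine ZMod.dft.injective (funext fun a ↦ ?_)
    rw [ZMod.dft_comp_unitMul (fun x ↦ if x ∈ T then (1 : ℂ) else 0) u a,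
      dft_indicator_eq_cayleyEigenvalue, dft_indicator_eq_cayleyEigenvalue, ← hT, mul_neg,
      Units.mul_inv_cancel_left]
  have hmem (x : ZMod n) : (u : ZMod n) * x ∈ T ↔ x ∈ T := by
    have := congrFun hind x
    by_cases h1 : (u : ZMod n) * x ∈ T <;> by_cases h2 : x ∈ T <;> simp_all
  refine Finset.eq_of_subset_of_card_le (fun y hy ↦ ?_) ?_
  · obtain ⟨x, hx, rfl⟩ := Finset.mem_image.1 hy
    exact (hmem x).2 hx
  · rw [Finset.card_image_of_injective _ fun x y h ↦ u.isUnit.mul_left_cancel h]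

end

/-- If `Cay(Z_n,S)` and `Cay(Z_n,T)` are isomorphic digraphs and `k` is a unit of
`Z_n` with `kS = S`, then `kT = T` (the Zibin property). -/
theorem stmt8 (n : ℕ) (hn : 0 < n) (S T : Finset (ZMod n))
    (hS : (0 : ZMod n) ∉ S) (hT : (0 : ZMod n) ∉ T)
    (φ : ZMod n → ZMod n) (hφ : Function.Bijective φ)
    (hiso : ∀ x y : ZMod n, y - x ∈ S ↔ φ y - φ x ∈ T)
    (k : ZMod n) (hk : IsUnit k) (hkS : S.image (fun s => k * s) = S) :
    T.image (fun s => k * s) = T := by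
  have : NeZero n := ⟨hn.ne'⟩
  obtain ⟨u, rfl⟩ := hk
  refine image_unit_mul_eq_of_cayleyEigenvalue u fun a ↦ ?_
  obtain ⟨b, hb⟩ := exists_cayleyEigenvalue_eq hφ hiso a
  rw [← cayleyEigenvalue_unit_mul_eq u hb, cayleyEigenvalue_unit_mul_of_image_eq u hkS, hb]
end

section
/- For every positive integer n, the number of subsets S ⊆ Z_n \ {0} for which there exists a unit a of Z_n with a ≠ 1 and aS = S is less than n·2^{−n/4}·2^{n−1}. Equivalently, a uniformly random connection set S ⊆ Z_n \ {0} is not multiplier-free with probability less than n·2^{−n/4}. -/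
/-- The orbits of a permutation `σ` admit a transversal `R`: it contains the fixed points, it
determines the `σ`-invariant sets, and it has at most half as many elements as there are points
and fixed points together. -/
theorem Equiv.Perm.exists_transversal {α : Type*} [Fintype α] [DecidableEq α]
    (σ : Equiv.Perm α) :
    ∃ R : Finset α, (∀ x, σ x = x → x ∈ R) ∧
      (∀ S T : Finset α, S.image σ = S → T.image σ = T → S ∩ R = T ∩ R → S = T) ∧
      2 * R.card ≤ Fintype.card α + (Finset.univ.filter fun x => σ x = x).card := by
  classical
  let rep : α → α := fun x => (Quotient.mk (SameCycle.setoid σ) x).out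
  have hrep : ∀ x, σ.SameCycle (rep x) x := fun x => Quotient.mk_out (s := SameCycle.setoid σ) x
  have rep_eq : ∀ x y, σ.SameCycle x y → rep x = rep y := fun x y h =>
    congrArg Quotient.out (Quotient.sound (s := SameCycle.setoid σ) h)
  let R : Finset α := Finset.univ.filter fun x => rep x = x
  have mem_R : ∀ x, x ∈ R ↔ rep x = x := fun x => by simp [R]
  have mem_iff : ∀ S : Finset α, S.image σ = S → ∀ x y, σ.SameCycle x y → (x ∈ S ↔ y ∈ S) := by
    intro S hS x y hxy
    have step : ∀ x, σ x ∈ S ↔ x ∈ S := by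
      intro x
      conv_lhs => rw [← hS]
      simp
    obtain ⟨k, -, -, rfl⟩ := hxy.exists_pow_eq σ
    clear hxy
    induction k with
    | zero => simp
    | succ k ih =>
      rw [pow_succ', mul_apply, step]
      exact ih
  refine ⟨R, ?_, ?_, ?_⟩
  · intro x hx
    rw [mem_R]
    exact ((hrep x).symm.eq_of_left hx).symm
  · intro S T hS hT h
    ext x
    rw [← mem_iff S hS _ _ (hrep x), ← mem_iff T hT _ _ (hrep x)]
    have hR : rep x ∈ R := (mem_R _).2 (rep_eq _ _ (hrep x))
    have := Finset.ext_iff.1 h (rep x)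
    simpa [hR] using this
  · have hcard : (R.image σ).card = R.card := Finset.card_image_of_injective _ σ.injective
    have hinter : R ∩ R.image σ ⊆ Finset.univ.filter fun x => σ x = x := by
      intro y hy
      obtain ⟨hy, hy'⟩ := Finset.mem_inter.1 hy
      obtain ⟨x, hx, rfl⟩ := Finset.mem_image.1 hy'
      rw [mem_R] at hx hy
      have : σ x = x :=
        hy.symm.trans ((rep_eq _ _ (sameCycle_apply_left.2 (SameCycle.refl σ x))).trans hx)
      simp [this]
    have h₁ := Finset.card_union_add_card_inter R (R.image σ)
    have h₂ := Finset.card_le_card hinter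
    have h₃ := Finset.card_le_univ (R ∪ R.image σ)
    omega

/-- A multiplier `a ≠ 1` fixes at most half of `ZMod n`. -/
theorem ZMod.two_mul_card_fixed_le {n : ℕ} [NeZero n] {a : ZMod n} (ha : a ≠ 1) :
    2 * (Finset.univ.filter fun x : ZMod n => a * x = x).card ≤ n := by
  set F := Finset.univ.filter fun x : ZMod n => a * x = x with hF
  have hdisj : Disjoint F (F.image (· + 1)) := by
    rw [Finset.disjoint_left]
    intro y hy hy'
    obtain ⟨x, hx, rfl⟩ := Finset.mem_image.1 hy'
    simp only [hF, Finset.mem_filter, Finset.mem_univ, true_and] at hx hy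
    exact ha (by linear_combination hy - hx)
  have h₁ := Finset.card_union_of_disjoint hdisj
  rw [Finset.card_image_of_injective _ (add_left_injective 1)] at h₁
  have h₂ := Finset.card_le_univ (F ∪ F.image (· + 1))
  rw [ZMod.card] at h₂
  omega

/-- The number of subsets of `ZMod n` avoiding `0` and invariant under a given nontrivial
multiplier is at most `2 ^ k` for some `k ≤ 3 * n / 4 - 1`. -/
theorem ZMod.exists_card_invariant_le {n : ℕ} [NeZero n] {a : ZMod n} (hu : IsUnit a)
    (ha : a ≠ 1) :
    ∃ k : ℕ, 4 * (k + 1) ≤ 3 * n ∧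
      (Finset.univ.filter fun S : Finset (ZMod n) =>
        0 ∉ S ∧ S.image (fun s => a * s) = S).card ≤ 2 ^ k := by
  obtain ⟨u, rfl⟩ := hu
  obtain ⟨R, hfix, hdet, hR⟩ := Equiv.Perm.exists_transversal u.mulLeft
  simp only [Units.mulLeft_apply, ZMod.card] at hfix hR
  have h0 : (0 : ZMod n) ∈ R := hfix 0 (mul_zero _)
  have hF := ZMod.two_mul_card_fixed_le ha
  have hpos := Finset.card_pos.2 ⟨0, h0⟩
  refine ⟨R.card - 1, by omega, ?_⟩
  rw [← Finset.card_erase_of_mem h0, ← Finset.card_powerset]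
  refine Finset.card_le_card_of_injOn (· ∩ R) ?_ ?_
  · intro S hS
    simp only [Finset.coe_filter, Finset.mem_univ, true_and, Set.mem_ofPred_eq] at hS
    simp only [Finset.coe_powerset, Set.mem_preimage, Set.mem_powerset_iff, Finset.coe_subset]
    intro x hx
    obtain ⟨hxS, hxR⟩ := Finset.mem_inter.1 hx
    exact Finset.mem_erase.2 ⟨fun h => hS.1 (h ▸ hxS), hxR⟩
  · intro S hS T hT h
    simp only [Finset.coe_filter, Finset.mem_univ, true_and, Set.mem_ofPred_eq] at hS hT
    exact hdet S T hS.2 hT.2 h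

/-- For every positive integer `n`, the number of connection sets `S ⊆ Z_n \ {0}`
that are not multiplier-free (i.e., `aS = S` for some unit `a ≠ 1`) is less than
`n · 2^{-n/4} · 2^{n-1}`. -/
theorem stmt9 (n : ℕ) (hn : 0 < n) :
    ({S : Finset (ZMod n) | (0 : ZMod n) ∉ S ∧
        ∃ a : ZMod n, IsUnit a ∧ a ≠ 1 ∧ S.image (fun s => a * s) = S}.ncard : ℝ) <
      (n : ℝ) * (2 : ℝ) ^ (-(n : ℝ) / 4) * 2 ^ (n - 1) := by
  classical
  have : NeZero n := ⟨hn.ne'⟩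
  let A : Finset (ZMod n) := Finset.univ.filter fun a => IsUnit a ∧ a ≠ 1
  let inv : ZMod n → Finset (Finset (ZMod n)) := fun a =>
    Finset.univ.filter fun S => 0 ∉ S ∧ S.image (fun s => a * s) = S
  have hset : {S : Finset (ZMod n) | (0 : ZMod n) ∉ S ∧
      ∃ a : ZMod n, IsUnit a ∧ a ≠ 1 ∧ S.image (fun s => a * s) = S} = ↑(A.biUnion inv) := by
    ext S
    simp only [A, inv, Set.mem_ofPred_eq, Finset.coe_biUnion, Finset.coe_filter, Finset.mem_univ,
      true_and, Set.mem_iUnion, exists_prop]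
    tauto
  rw [hset, Set.ncard_coe_finset]
  set B : ℝ := (2 : ℝ) ^ (-(n : ℝ) / 4) * 2 ^ (n - 1) with hB
  have hBpos : 0 < B := by positivity
  have hbound : ∀ a ∈ A, ((inv a).card : ℝ) ≤ B := by
    intro a ha
    obtain ⟨hu, h1⟩ := (Finset.mem_filter.1 ha).2
    obtain ⟨k, hk, hcard⟩ := ZMod.exists_card_invariant_le hu h1
    calc ((inv a).card : ℝ) ≤ (2 : ℝ) ^ k := by exact_mod_cast hcard
      _ = (2 : ℝ) ^ (k : ℝ) := (Real.rpow_natCast _ _).symm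
      _ ≤ (2 : ℝ) ^ (-(n : ℝ) / 4 + ((n - 1 : ℕ) : ℝ)) := by
        apply Real.rpow_le_rpow_of_exponent_le one_le_two
        have hk' : (4 : ℝ) * (k + 1) ≤ 3 * n := by exact_mod_cast hk
        rw [Nat.cast_pred hn]
        linarith
      _ = B := by rw [Real.rpow_add two_pos, Real.rpow_natCast]
  have hA : A.card < n := by
    have h : A ⊂ Finset.univ :=
      (Finset.ssubset_univ_iff).2 fun h => by
        have : (1 : ZMod n) ∈ A := h ▸ Finset.mem_univ _
        simp [A] at this
    simpa [ZMod.card] using Finset.card_lt_card h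
  calc ((A.biUnion inv).card : ℝ) ≤ ∑ a ∈ A, ((inv a).card : ℝ) := by
        exact_mod_cast Finset.card_biUnion_le
    _ ≤ A.card * B := by simpa using Finset.sum_le_card_nsmul A _ B hbound
    _ < n * B := by gcongr
    _ = _ := by rw [hB, mul_assoc]
end

section
/- Let n be a positive integer and let a be a unit of Z_n with a ≠ 1. Then the number of subsets S ⊆ Z_n \ {0} with aS = S is at most 2^{−n/4}·2^{n−1}; i.e., a uniformly random subset S ⊆ Z_n \ {0} satisfies aS = S with probability at most 2^{−n/4}. -/
open scoped Classical in
/-- Twice the number of orbits of a permutation is at most the number of points plus the number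
of fixed points. -/
theorem Equiv.Perm.two_mul_card_quotient_sameCycle_le {α : Type*} [Fintype α] (σ : Equiv.Perm α) :
    2 * Fintype.card (Quotient (Equiv.Perm.SameCycle.setoid σ)) ≤
      Fintype.card α + (Finset.univ.filter fun x => σ x = x).card := by
  let mk : α → Quotient (Equiv.Perm.SameCycle.setoid σ) := fun x => Quotient.mk _ x
  rw [← Finset.card_univ (α := α),
    Finset.card_eq_sum_card_fiberwise (f := mk) (s := Finset.univ) (t := Finset.univ)
      (fun _ _ => by simp),
    Finset.card_eq_sum_card_fiberwise (f := mk) (s := Finset.univ.filter fun x => σ x = x)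
      (t := Finset.univ) (fun _ _ => by simp), ← Finset.sum_add_distrib, mul_comm,
    ← Finset.card_univ, ← smul_eq_mul]
  refine Finset.card_nsmul_le_sum _ _ _ fun q _ => ?_
  obtain ⟨x, rfl⟩ := Quotient.exists_rep q
  by_cases hx : σ x = x
  · have h₁ : 0 < (Finset.univ.filter fun y => mk y = mk x).card :=
      Finset.card_pos.2 ⟨x, by simp⟩
    have h₂ : 0 < ((Finset.univ.filter fun y => σ y = y).filter fun y => mk y = mk x).card :=
      Finset.card_pos.2 ⟨x, by simp [hx]⟩
    exact Nat.add_le_add h₁ h₂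
  · have hσ : mk (σ x) = mk x :=
      Quotient.sound (Equiv.Perm.sameCycle_apply_left.2 (Equiv.Perm.SameCycle.refl σ x))
    have h : 1 < (Finset.univ.filter fun y => mk y = mk x).card :=
      Finset.one_lt_card.2 ⟨σ x, by simp [hσ], x, by simp, hx⟩
    exact Nat.le_add_right_of_le h

theorem Equiv.Perm.SameCycle.mem_of_image_eq {α : Type*} [Finite α] [DecidableEq α]
    {σ : Equiv.Perm α} {S : Finset α} (hS : S.image σ = S) {x y : α} (h : σ.SameCycle x y)
    (hx : x ∈ S) : y ∈ S := by
  obtain ⟨i, -, rfl⟩ := h.exists_pow_eq'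
  induction i with
  | zero => simpa
  | succ k ih =>
    rw [pow_succ', Equiv.Perm.mul_apply, ← hS]
    exact Finset.mem_image_of_mem _ (ih ⟨k, by simp⟩)

open scoped Classical in
/-- The number of invariant sets of a permutation avoiding a given point is at most two to the
number of the other orbits. -/
theorem Equiv.Perm.ncard_invariant_le {α : Type*} [Fintype α] (σ : Equiv.Perm α) (x : α) :
    {S : Finset α | x ∉ S ∧ S.image σ = S}.ncard ≤
      2 ^ (Fintype.card (Quotient (Equiv.Perm.SameCycle.setoid σ)) - 1) := by
  let mk : α → Quotient (Equiv.Perm.SameCycle.setoid σ) := fun x => Quotient.mk _ x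
  have hmk {y z : α} (h : mk y = mk z) : σ.SameCycle y z := Quotient.exact h
  have hcard : (Finset.univ.erase (mk x)).powerset.card =
      2 ^ (Fintype.card (Quotient (Equiv.Perm.SameCycle.setoid σ)) - 1) := by
    rw [Finset.card_powerset, Finset.card_erase_of_mem (Finset.mem_univ _), Finset.card_univ]
  rw [← hcard, ← Set.ncard_coe_finset]
  refine Set.ncard_le_ncard_of_injOn (fun S => S.image mk) ?_ ?_ (Finset.finite_toSet _)
  · rintro S ⟨hxS, hS⟩
    simp only [Finset.coe_powerset, Set.mem_preimage, Set.mem_powerset_iff, Finset.coe_subset]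
    refine Finset.subset_erase.2 ⟨Finset.subset_univ _, fun h => ?_⟩
    obtain ⟨s, hs, hsx⟩ := Finset.mem_image.1 h
    exact hxS ((hmk hsx).mem_of_image_eq hS hs)
  · have key {S T : Finset α} (hT : T.image σ = T) (h : S.image mk = T.image mk) : S ⊆ T := by
      intro s hs
      have hs' : mk s ∈ T.image mk := h ▸ Finset.mem_image_of_mem mk hs
      obtain ⟨t, ht, hts⟩ := Finset.mem_image.1 hs'
      exact (hmk hts).mem_of_image_eq hT ht
    rintro S ⟨-, hS⟩ T ⟨-, hT⟩ h
    exact (key hT h).antisymm (key hS h.symm)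

/-- Multiplication by `a ≠ 1` fixes at most half of the elements of a finite ring. -/
theorem two_mul_card_mul_eq_self_le {R : Type*} [Ring R] [Fintype R] [DecidableEq R] {a : R}
    (h1 : a ≠ 1) : 2 * (Finset.univ.filter fun x => a * x = x).card ≤ Fintype.card R := by
  let H : AddSubgroup R := (AddMonoidHom.mulLeft (a - 1)).ker
  have hH : H.index ≠ 1 := fun h => h1 <| by
    have : (1 : R) ∈ H := AddSubgroup.index_eq_one.1 h ▸ AddSubgroup.mem_top 1
    simpa [H, AddMonoidHom.mem_ker, sub_eq_zero] using this
  have hcard : (Finset.univ.filter fun x => a * x = x).card = Nat.card H := by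
    rw [← Set.ncard_coe_finset, ← Nat.card_coe_set_eq]
    congr! 2
    ext x
    simp [H, AddMonoidHom.mem_ker, sub_mul, sub_eq_zero]
  have h0 : H.index ≠ 0 := AddSubgroup.index_ne_zero_of_finite
  rw [hcard, ← Nat.card_eq_fintype_card, ← H.card_mul_index, mul_comm]
  exact Nat.mul_le_mul_left _ (by omega)

/-- For a unit `a ≠ 1` of `Z_n`, the number of subsets `S ⊆ Z_n \ {0}` with
`aS = S` is at most `2^{-n/4} · 2^{n-1}`. -/
theorem stmt12 (n : ℕ) (hn : 0 < n) (a : ZMod n) (ha : IsUnit a) (h1 : a ≠ 1) :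
    ({S : Finset (ZMod n) | (0 : ZMod n) ∉ S ∧
        S.image (fun s => a * s) = S}.ncard : ℝ) ≤
      (2 : ℝ) ^ (-(n : ℝ) / 4) * 2 ^ (n - 1) := by
  classical
  have : NeZero n := ⟨hn.ne'⟩
  obtain ⟨u, rfl⟩ := ha
  let σ : Equiv.Perm (ZMod n) := Units.mulLeft u
  let k := Fintype.card (Quotient (Equiv.Perm.SameCycle.setoid σ))
  have hk : 0 < k := Fintype.card_pos_iff.2 ⟨Quotient.mk _ 0⟩
  have hfix : 2 * (Finset.univ.filter fun x => σ x = x).card ≤ n := by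
    simpa [σ, ZMod.card] using two_mul_card_mul_eq_self_le h1
  have horb : 2 * k ≤ n + (Finset.univ.filter fun x => σ x = x).card := by
    convert σ.two_mul_card_quotient_sameCycle_le
    exact (ZMod.card n).symm
  have h4 : (4 * k : ℝ) ≤ 3 * n := by exact_mod_cast (by omega : 4 * k ≤ 3 * n)
  have hcount : {S : Finset (ZMod n) | (0 : ZMod n) ∉ S ∧
      S.image (fun s => (u : ZMod n) * s) = S}.ncard ≤ 2 ^ (k - 1) := by
    convert σ.ncard_invariant_le 0
    rfl
  calc _ ≤ (2 : ℝ) ^ (k - 1) := by exact_mod_cast hcount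
    _ ≤ (2 : ℝ) ^ (-(n : ℝ) / 4) * 2 ^ (n - 1) := by
      rw [← Real.rpow_natCast, ← Real.rpow_natCast, ← Real.rpow_add two_pos,
        Nat.cast_pred hk, Nat.cast_pred hn]
      exact Real.rpow_le_rpow_of_exponent_le one_le_two (by linarith)
end

section
/- Let p be a prime and n = 3p. Let S ⊆ Z_n \ {0}, and for r ∈ {1,2} let S_r = {s ∈ S : s ≡ r (mod 3)}, where the residue mod 3 of an element of Z_n is well defined since 3 divides n. If |S_1| = |S_2|, then λ_{p,S} = λ_{2p,S}; that is, the Cayley digraph Cay(Z_n,S) has a repeated eigenvalue. -/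
theorem zetaC_pow_self (n : ℕ) (hn : n ≠ 0) : zetaC n ^ n = 1 := by
  have hn' : (n : ℂ) ≠ 0 := by exact_mod_cast hn
  rw [zetaC, ← Complex.exp_nat_mul, mul_div_cancel₀ _ hn', Complex.exp_neg,
    Complex.exp_two_pi_mul_I, inv_one]

theorem zetaC_pow_val_natCast (n : ℕ) (hn : n ≠ 0) (m : ℕ) :
    zetaC n ^ (m : ZMod n).val = zetaC n ^ m := by
  rw [ZMod.val_natCast, ← pow_eq_pow_mod m (zetaC_pow_self n hn)]

theorem cayEig_natCast (n : ℕ) (hn : n ≠ 0) (S : Finset (ZMod n)) (a : ℕ) :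
    cayEig n S (a : ZMod n) = ∑ j ∈ S, (zetaC n ^ a) ^ j.val := by
  have : NeZero n := ⟨hn⟩
  refine Finset.sum_congr rfl fun j _ => ?_
  rw [← pow_mul, ← zetaC_pow_val_natCast n hn (a * j.val), Nat.cast_mul, ZMod.natCast_zmod_val]

theorem pow_sub_sq_pow_of_cube_eq_one {R : Type*} [CommRing R] {w : R} (hw : w ^ 3 = 1) (m : ℕ) :
    w ^ m - (w ^ 2) ^ m =
      (if m % 3 = 1 then w - w ^ 2 else 0) - (if m % 3 = 2 then w - w ^ 2 else 0) := by
  have hw2 : (w ^ 2) ^ 3 = 1 := by rw [pow_right_comm, hw, one_pow]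
  rw [pow_eq_pow_mod m hw, pow_eq_pow_mod m hw2]
  have hlt : m % 3 < 3 := Nat.mod_lt _ (by norm_num)
  interval_cases m % 3
  · simp
  · simp
  · simp only [OfNat.ofNat_ne_one, if_true, if_false]
    linear_combination (-w) * hw

/-- For `n = 3p` with `p` prime and `S ⊆ Z_n \ {0}`: if the parts of `S` consisting
of elements congruent to `1` and to `2` modulo `3` have the same size, then
`λ_{p,S} = λ_{2p,S}`, i.e. `Cay(Z_n,S)` has a repeated eigenvalue. -/
theorem stmt13 (p : ℕ) (hp : p.Prime) (S : Finset (ZMod (3 * p)))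
    (hS : (0 : ZMod (3 * p)) ∉ S)
    (h : (S.filter (fun s => s.val % 3 = 1)).card =
         (S.filter (fun s => s.val % 3 = 2)).card) :
    cayEig (3 * p) S (p : ZMod (3 * p)) = cayEig (3 * p) S ((2 * p : ℕ) : ZMod (3 * p)) := by
  have hn : 3 * p ≠ 0 := mul_ne_zero three_ne_zero hp.ne_zero
  have hw : (zetaC (3 * p) ^ p) ^ 3 = 1 := by
    rw [← pow_mul, mul_comm p 3, zetaC_pow_self _ hn]
  rw [cayEig_natCast _ hn, cayEig_natCast _ hn, mul_comm 2 p, pow_mul, ← sub_eq_zero,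
    ← Finset.sum_sub_distrib]
  simp_rw [pow_sub_sq_pow_of_cube_eq_one hw]
  rw [Finset.sum_sub_distrib, ← Finset.sum_filter, ← Finset.sum_filter, Finset.sum_const,
    Finset.sum_const, h, sub_self]
end

section
/- For every ε > 0 there exists N such that for all n ≥ N the following holds. Let R be any family of subsets of Z_n \ {0} that is isomorphism-invariant, i.e., if S ∈ R and Cay(Z_n,T) is isomorphic to Cay(Z_n,S) as a digraph, then T ∈ R. Let u(R) denote the number of isomorphism classes of the digraphs {Cay(Z_n,S) : S ∈ R}, and let u(C) denote the number of isomorphism classes of all Cayley digraphs of Z_n. Then u(R)/u(C) ≤ (1+ε)·|R|·2^{−(n−1)} + n²·2^{−n/4}. -/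
/-- The Cayley digraphs `Cay(Z_n,S)` and `Cay(Z_n,T)` are isomorphic. -/
def CayIso (n : ℕ) (S T : Finset (ZMod n)) : Prop :=
  ∃ φ : ZMod n ≃ ZMod n, ∀ x y : ZMod n, y - x ∈ S ↔ φ y - φ x ∈ T

/-- The number of isomorphism classes of the digraphs `{Cay(Z_n,S) : S ∈ R}`. -/
noncomputable def numIsoClasses (n : ℕ) (R : Set (Finset (ZMod n))) : ℕ :=
  ((fun S => {T : Finset (ZMod n) | CayIso n S T}) '' R).ncard

theorem CayIso.refl {n : ℕ} (S : Finset (ZMod n)) : CayIso n S S :=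
  ⟨Equiv.refl _, fun _ _ => Iff.rfl⟩

theorem CayIso.symm {n : ℕ} {S T : Finset (ZMod n)} : CayIso n S T → CayIso n T S := by
  rintro ⟨φ, h⟩
  exact ⟨φ.symm, fun x y => by simp [h]⟩

theorem CayIso.trans {n : ℕ} {S T U : Finset (ZMod n)} :
    CayIso n S T → CayIso n T U → CayIso n S U := by
  rintro ⟨φ, h⟩ ⟨ψ, h'⟩
  exact ⟨φ.trans ψ, fun x y => by simp [h, h']⟩

theorem CayIso.zero_mem_iff {n : ℕ} {S T : Finset (ZMod n)} (h : CayIso n S T) :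
    (0 : ZMod n) ∈ S ↔ (0 : ZMod n) ∈ T := by
  obtain ⟨φ, h⟩ := h
  simpa using h 0 0

theorem cayIso_image_units_mul {n : ℕ} (u : (ZMod n)ˣ) (S : Finset (ZMod n)) :
    CayIso n S (S.image (u.mulLeft ·)) := by
  refine ⟨u.mulLeft, fun x y => ?_⟩
  simp [← mul_sub]

theorem setOf_cayIso_eq_iff {n : ℕ} {S T : Finset (ZMod n)} :
    {U | CayIso n S U} = {U | CayIso n T U} ↔ CayIso n S T := by
  refine ⟨fun h => ?_, fun h => ?_⟩
  · exact (Set.ext_iff.1 h T).2 (CayIso.refl T)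
  · ext U
    exact ⟨fun hU => h.symm.trans hU, fun hU => h.trans hU⟩

/-- Fourier inversion on `ZMod n`. -/
theorem natCast_mul_eq_sum_fourier {n : ℕ} [NeZero n] {L : Type*} [Field L]
    {ψ : AddChar (ZMod n) L} (hψ : ψ.IsPrimitive)
    (F : ZMod n → L) (y : ZMod n) :
    (n : L) * F y = ∑ j, ψ (j * y) * ∑ x, F x * ψ (-(j * x)) := by
  have h (x : ZMod n) : ∑ j, ψ (j * y) * (F x * ψ (-(j * x))) =
      if y - x = 0 then n * F x else 0 := by
    have := AddChar.sum_mulShift (y - x) hψ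
    simp_rw [mul_sub, sub_eq_add_neg, AddChar.map_add_eq_mul] at this
    calc _ = F x * ∑ j, ψ (j * y) * ψ (-(j * x)) := by
          rw [Finset.mul_sum]; exact Finset.sum_congr rfl fun j _ => by ring
      _ = _ := by
          rw [this]
          simp only [← sub_eq_add_neg, ZMod.card]
          split_ifs <;> simp [mul_comm]
  simp_rw [Finset.mul_sum]
  rw [Finset.sum_comm]
  simp_rw [h, sub_eq_zero]
  simp

/-- An eigenfunction of `Cay(Z_n,S)` has nonzero Fourier coefficients only at characters with the
same eigenvalue. -/
theorem sum_fourier_of_eigen {n : ℕ} [NeZero n] {L : Type*} [Field L]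
    {ψ : AddChar (ZMod n) L}
    {F : ZMod n → L} {S : Finset (ZMod n)} {μ : L} (hF : ∀ x, ∑ s ∈ S, F (x + s) = μ * F x)
    (j : ZMod n) :
    μ * ∑ x, F x * ψ (-(j * x)) = (∑ s ∈ S, ψ (j * s)) * ∑ x, F x * ψ (-(j * x)) := by
  calc μ * ∑ x, F x * ψ (-(j * x)) = ∑ x, (∑ s ∈ S, F (x + s)) * ψ (-(j * x)) := by
        simp_rw [hF, Finset.mul_sum, mul_assoc]
    _ = ∑ s ∈ S, ∑ x, F (x + s) * ψ (-(j * x)) := by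
        simp_rw [Finset.sum_mul]; rw [Finset.sum_comm]
    _ = ∑ s ∈ S, ∑ x, F x * ψ (-(j * x)) * ψ (j * s) := by
        refine Finset.sum_congr rfl fun s _ => ?_
        refine Fintype.sum_equiv (Equiv.addRight s) _ _ fun x => ?_
        simp only [Equiv.coe_addRight]
        rw [mul_assoc, ← AddChar.map_add_eq_mul]
        congr 2
        ring
    _ = _ := by
        simp_rw [← Finset.sum_mul]
        rw [← Finset.mul_sum, mul_comm]

theorem sum_comp_equiv_of_cayIso {n : ℕ} {L : Type*} [Field L]
    {φ : ZMod n ≃ ZMod n} {S T : Finset (ZMod n)}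
    (h : ∀ x y : ZMod n, y - x ∈ S ↔ φ y - φ x ∈ T) (F : ZMod n → L) (x : ZMod n) :
    ∑ s ∈ S, F (φ (x + s)) = ∑ t ∈ T, F (φ x + t) := by
  refine Finset.sum_bij (fun s _ => φ (x + s) - φ x) ?_ ?_ ?_ ?_
  · intro s hs
    rw [← h]
    simpa using hs
  · intro a _ b _ hab
    simpa using hab
  · intro t ht
    refine ⟨φ.symm (φ x + t) - x, ?_, by simp⟩
    rw [h]
    simpa using ht
  · intro s _
    simp

/-- If the eigenvalue of `Cay(Z_n,S)` at a primitive character is simple, then every digraph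
`Cay(Z_n,T)` isomorphic to it arises by multiplying `S` by a unit. -/
theorem exists_units_of_cayIso {n : ℕ} [NeZero n] {L : Type*} [Field L]
    [CharZero L] {ψ : AddChar (ZMod n) L} (hψ : ψ.IsPrimitive)
    (hinj : Function.Injective ψ)
    {S T : Finset (ZMod n)} (hS : ∀ j : ZMod n, j ≠ 1 → ∑ s ∈ S, ψ s ≠ ∑ s ∈ S, ψ (j * s))
    (hST : CayIso n S T) : ∃ u : (ZMod n)ˣ, T = S.image (u.mulLeft ·) := by
  have hn : (n : L) ≠ 0 := Nat.cast_ne_zero.2 (NeZero.ne n)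
  obtain ⟨φ, h0, h⟩ : ∃ φ : ZMod n ≃ ZMod n, φ 0 = 0 ∧
      ∀ x y : ZMod n, y - x ∈ S ↔ φ y - φ x ∈ T := by
    obtain ⟨φ, h⟩ := hST
    exact ⟨φ.trans (Equiv.subRight (φ 0)), by simp, fun x y => by simp [h]⟩
  have h' (x y : ZMod n) : y - x ∈ T ↔ φ.symm y - φ.symm x ∈ S := by simp [h]
  set μ := ∑ s ∈ S, ψ s with hμ
  obtain ⟨k, hk⟩ : ∃ k : ZMod n, ∑ x, ψ (φ.symm x) * ψ (-(k * x)) ≠ 0 := by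
    by_contra! hc
    have := natCast_mul_eq_sum_fourier hψ (fun x => ψ (φ.symm x)) 0
    simp only [hc, mul_zero, Finset.sum_const_zero, mul_eq_zero, hn, false_or] at this
    exact (AddChar.val_isUnit ψ _).ne_zero this
  have hkT : μ = ∑ t ∈ T, ψ (k * t) := by
    refine mul_right_cancel₀ hk (sum_fourier_of_eigen (fun x => ?_) k)
    rw [sum_comp_equiv_of_cayIso h' (fun x => ψ x) x, hμ]
    simp_rw [AddChar.map_add_eq_mul]
    rw [← Finset.mul_sum, mul_comm]
  have hF (x : ZMod n) : ∑ s ∈ S, ψ (k * φ (x + s)) = μ * ψ (k * φ x) := by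
    rw [sum_comp_equiv_of_cayIso h (fun x => ψ (k * x)) x, hkT]
    simp_rw [mul_add, AddChar.map_add_eq_mul]
    rw [← Finset.mul_sum, mul_comm]
  have hz (j : ZMod n) (hj : j ≠ 1) : ∑ x, ψ (k * φ x) * ψ (-(j * x)) = 0 := by
    by_contra hne
    exact hS j hj (mul_right_cancel₀ hne (sum_fourier_of_eigen hF j))
  have hc (y : ZMod n) : (n : L) * ψ (k * φ y) = ψ y * ∑ x, ψ (k * φ x) * ψ (-(1 * x)) := by
    rw [natCast_mul_eq_sum_fourier hψ (fun x => ψ (k * φ x)) y,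
      Finset.sum_eq_single 1 (fun j _ hj => by rw [hz j hj, mul_zero]) (by simp), one_mul]
  have hkφ (y : ZMod n) : k * φ y = y := by
    apply hinj
    have h1 := hc 0
    have h2 := hc y
    simp only [h0, mul_zero, AddChar.map_zero_eq_one, mul_one, one_mul] at h1
    simp only [one_mul] at h2
    rw [← h1, mul_comm (ψ y)] at h2
    exact mul_left_cancel₀ hn h2
  have hk1 : k * φ 1 = 1 := hkφ 1
  refine ⟨⟨φ 1, k, by rw [mul_comm, hk1], hk1⟩, ?_⟩
  have hφ (y : ZMod n) : φ y = φ 1 * y := by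
    conv_rhs => rw [← hkφ y, ← mul_assoc, mul_comm (φ 1), hk1, one_mul]
  ext t
  have := h 0 (φ.symm t)
  simp only [sub_zero, h0, Equiv.apply_symm_apply] at this
  rw [← this]
  simp only [Finset.mem_image, Units.mulLeft_apply]
  constructor
  · intro ht
    exact ⟨_, ht, by rw [← hφ]; simp⟩
  · rintro ⟨s, hs, rfl⟩
    rw [← hφ]
    simpa using hs

/-- At most a `2 ^ (-r)` proportion of the subsets of a finite index set have vanishing sum, where
`r` is the rank of the family summed over. -/
theorem card_sum_eq_zero_mul_two_pow_finrank_le {ι V : Type*} [Fintype ι] [DecidableEq ι]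
    [AddCommGroup V] [Module ℚ V] [DecidableEq V] (c : ι → V) :
    (Finset.univ.filter fun S : Finset ι => ∑ s ∈ S, c s = 0).card *
      2 ^ Module.finrank ℚ (Submodule.span ℚ (Set.range c)) ≤ 2 ^ Fintype.card ι := by
  obtain ⟨κ, a, ha, hspan, hli⟩ := exists_linearIndependent' ℚ c
  have : Finite κ := Finite.of_injective a ha
  have := Fintype.ofFinite κ
  set I : Finset ι := Finset.univ.map ⟨a, ha⟩ with hI
  have hr : Module.finrank ℚ (Submodule.span ℚ (Set.range c)) = I.card := by
    rw [← hspan, finrank_span_eq_card hli, hI, Finset.card_map, Finset.card_univ]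
  have hsplit (S : Finset ι) :
      ∑ s ∈ S, c s = ∑ s ∈ S \ I, c s + ∑ k, (if a k ∈ S then (1 : ℚ) else 0) • c (a k) := by
    rw [← Finset.sum_inter_add_sum_sdiff S I, add_comm, Finset.inter_comm,
      ← Finset.filter_mem_eq_inter, Finset.sum_filter, hI, Finset.sum_map]
    simp [ite_smul]
  have hle : (Finset.univ.filter fun S : Finset ι => ∑ s ∈ S, c s = 0).card ≤
      Iᶜ.powerset.card := by
    refine Finset.card_le_card_of_injOn (fun S => S \ I)
      (fun S _ => by simp) ?_
    intro S hS T hT hST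
    simp only [Finset.coe_filter, Finset.mem_univ, true_and, Set.mem_ofPred_eq] at hS hT hST
    rw [hsplit] at hS hT
    rw [hST] at hS
    have h0 := add_left_cancel (hS.trans hT.symm)
    rw [← sub_eq_zero, ← Finset.sum_sub_distrib] at h0
    simp_rw [← sub_smul] at h0
    have hk := Fintype.linearIndependent_iff.1 hli _ h0
    ext x
    by_cases hx : x ∈ I
    · obtain ⟨k, -, rfl⟩ := Finset.mem_map.1 hx
      have := hk k
      simp only [Function.Embedding.coeFn_mk]
      by_cases h1 : a k ∈ S <;> by_cases h2 : a k ∈ T <;> simp [h1, h2] at this ⊢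
    · have := congrArg (x ∈ ·) hST
      simpa [hx] using this
  rw [hr, ← Finset.card_add_card_compl I, add_comm, pow_add]
  rw [Finset.card_powerset] at hle
  gcongr

theorem le_two_mul_totient_sq_s14 (n : ℕ) : n ≤ 2 * n.totient ^ 2 := by
  suffices h : n ≤ (if Even n then 2 else 1) * n.totient ^ 2 by
    refine h.trans (Nat.mul_le_mul_right _ ?_)
    split_ifs <;> norm_num
  induction n using Nat.recOnPosPrimePosCoprime with
  | zero => simp
  | one => simp
  | prime_pow p k hp hk =>
    obtain ⟨k, rfl⟩ := Nat.exists_eq_succ_of_ne_zero hk.ne'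
    rw [Nat.succ_eq_add_one, Nat.totient_prime_pow_succ hp]
    have h1 : p ≤ (if Even (p ^ (k + 1)) then 2 else 1) * (p - 1) ^ 2 := by
      rcases hp.eq_two_or_odd' with rfl | hodd
      · simp [Nat.even_pow]
      · have : ¬ Even (p ^ (k + 1)) := Nat.not_even_iff_odd.2 hodd.pow
        rw [if_neg this, one_mul]
        obtain ⟨m, rfl⟩ := hodd
        have : 1 ≤ m := by have := hp.two_le; omega
        simp only [Nat.add_sub_cancel]
        nlinarith
    have h2 : 1 ≤ p ^ k := Nat.one_le_pow _ _ hp.pos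
    calc p ^ (k + 1) = p ^ k * p := pow_succ _ _
      _ ≤ p ^ k * ((if Even (p ^ (k + 1)) then 2 else 1) * (p - 1) ^ 2) := by gcongr
      _ ≤ (p ^ k * p ^ k) * ((if Even (p ^ (k + 1)) then 2 else 1) * (p - 1) ^ 2) :=
        Nat.mul_le_mul_right _ (Nat.le_mul_of_pos_left _ h2)
      _ = _ := by ring
  | coprime a b _ _ hab ha hb =>
    rw [Nat.totient_mul hab]
    calc a * b ≤ ((if Even a then 2 else 1) * a.totient ^ 2) *
          ((if Even b then 2 else 1) * b.totient ^ 2) := Nat.mul_le_mul ha hb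
      _ = (if Even a then 2 else 1) * (if Even b then 2 else 1) *
          (a.totient * b.totient) ^ 2 := by ring
      _ = _ := by
        congr 1
        by_cases h1 : Even a <;> by_cases h2 : Even b <;> simp [h1, h2, Nat.even_mul]
        exact (Nat.not_coprime_of_dvd_of_dvd one_lt_two h1.two_dvd h2.two_dvd hab).elim

theorem two_mul_totient_le {n : ℕ} (hn : Even n) : 2 * n.totient ≤ n := by
  induction n using Nat.strong_induction_on with
  | _ n ih =>
    obtain ⟨m, rfl⟩ := hn
    rw [← two_mul]
    rcases Nat.even_or_odd m with h | h
    · rw [Nat.totient_two_mul_of_even h]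
      rcases Nat.eq_zero_or_pos m with rfl | hm
      · simp
      · exact Nat.mul_le_mul_left 2 (ih m (by omega) h)
    · rw [Nat.totient_two_mul_of_odd h]
      exact Nat.mul_le_mul_left 2 (Nat.totient_le m)

theorem zmodChar_injective_of_isPrimitiveRoot {n : ℕ} [NeZero n] {C : Type*} [CommMonoid C] {ζ : C}
    (hζ : IsPrimitiveRoot ζ n) : Function.Injective (AddChar.zmodChar n hζ.pow_eq_one) := by
  intro x y hxy
  simp only [AddChar.zmodChar_apply] at hxy
  exact ZMod.val_injective n (hζ.pow_inj (ZMod.val_lt x) (ZMod.val_lt y) hxy)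


theorem span_range_eq_top_of_isPrimitiveRoot {n : ℕ} [NeZero n] {L : Type*} [Field L]
    [CharZero L]
    [IsCyclotomicExtension {n} ℚ L] {ζ : L} (hζ : IsPrimitiveRoot ζ n) :
    Submodule.span ℚ (Set.range (AddChar.zmodChar n hζ.pow_eq_one)) = ⊤ := by
  rw [eq_top_iff, ← Algebra.top_toSubmodule,
    ← IsCyclotomicExtension.adjoin_primitive_root_eq_top (A := ℚ) hζ, Algebra.adjoin_eq_span]
  refine Submodule.span_mono ?_
  intro x hx
  obtain ⟨k, rfl⟩ := Submonoid.mem_closure_singleton.1 hx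
  exact ⟨k, AddChar.zmodChar_apply' _ k⟩

theorem two_mul_finrank_ker_id_sub_le {K L : Type*} [Field K] [Field L] [Algebra K L]
    [FiniteDimensional K L] (σ : L ≃ₐ[K] L) {z : L} (hz : σ z ≠ z) :
    2 * Module.finrank K (LinearMap.ker (LinearMap.id - σ.toLinearMap)) ≤ Module.finrank K L := by
  set W := LinearMap.ker (LinearMap.id - σ.toLinearMap) with hW
  have hmem (x : L) : x ∈ W ↔ σ x = x := by
    rw [hW, LinearMap.mem_ker, LinearMap.sub_apply, sub_eq_zero, eq_comm]
    rfl
  have hz0 : z ≠ 0 := fun h => hz (by rw [h, map_zero])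
  have hdisj : Disjoint W (W.map (LinearMap.mulLeft K z)) := by
    rw [Submodule.disjoint_def]
    rintro _ hx ⟨w, hw, rfl⟩
    rw [SetLike.mem_coe, hmem] at hw
    rw [hmem, LinearMap.mulLeft_apply, map_mul, hw] at hx
    by_contra hne
    exact hz (mul_right_cancel₀ (right_ne_zero_of_mul hne) hx)
  have heq : Module.finrank K (W.map (LinearMap.mulLeft K z)) = Module.finrank K W :=
    (LinearEquiv.finrank_eq
      (W.equivMapOfInjective _ (mul_right_injective₀ hz0))).symm
  have := Submodule.finrank_add_finrank_le_of_disjoint hdisj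
  omega

/-- The eigenvalue of `Cay(Z_n,S)` at a faithful character minus the one at any other character is
a linear function of `S` of rank at least `φ(n) / 2`. -/
theorem totient_le_two_mul_finrank_span {n : ℕ} [NeZero n] {L : Type*} [Field L] [CharZero L]
    [IsCyclotomicExtension {n} ℚ L] {ζ : L} (hζ : IsPrimitiveRoot ζ n) {j : ZMod n} (hj : j ≠ 1) :
    n.totient ≤ 2 * Module.finrank ℚ (Submodule.span ℚ (Set.range fun s : ZMod n =>
      AddChar.zmodChar n hζ.pow_eq_one s - AddChar.zmodChar n hζ.pow_eq_one (j * s))) := by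
  set ψ := AddChar.zmodChar n hζ.pow_eq_one with hψ
  have hspan : Submodule.span ℚ (Set.range ψ) = ⊤ := span_range_eq_top_of_isPrimitiveRoot hζ
  have hinj : Function.Injective ψ := zmodChar_injective_of_isPrimitiveRoot hζ
  have : FiniteDimensional ℚ L := IsCyclotomicExtension.finiteDimensional {n} ℚ L
  have hfin : Module.finrank ℚ L = n.totient :=
    IsCyclotomicExtension.finrank L (Polynomial.cyclotomic.irreducible_rat (NeZero.pos n))
  set V := Submodule.span ℚ (Set.range fun s => ψ s - ψ (j * s)) with hV
  by_cases hu : IsUnit j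
  · obtain ⟨u, rfl⟩ := hu
    have hirr := Polynomial.cyclotomic.irreducible_rat (NeZero.pos n)
    obtain ⟨σ, hσ⟩ : ∃ σ : L ≃ₐ[ℚ] L, ∀ x, σ (ψ x) = ψ (u * x) := by
      have hμ : IsPrimitiveRoot (ζ ^ (u : ZMod n).val) n :=
        hζ.pow_of_coprime _ (ZMod.val_coe_unit_coprime u)
      have hmin : minpoly ℚ (hζ.powerBasis ℚ).gen = minpoly ℚ (hμ.powerBasis ℚ).gen := by
        simp only [IsPrimitiveRoot.powerBasis_gen]
        rw [← hζ.minpoly_eq_cyclotomic_of_irreducible hirr,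
          ← hμ.minpoly_eq_cyclotomic_of_irreducible hirr]
      refine ⟨(hζ.powerBasis ℚ).equivOfMinpoly (hμ.powerBasis ℚ) hmin, fun x => ?_⟩
      have h1 := (hζ.powerBasis ℚ).equivOfMinpoly_gen (hμ.powerBasis ℚ) hmin
      simp only [IsPrimitiveRoot.powerBasis_gen] at h1
      rw [hψ, AddChar.zmodChar_apply, map_pow, h1, ← pow_mul,
        ← AddChar.zmodChar_apply' hζ.pow_eq_one]
      simp
    set f : L →ₗ[ℚ] L := LinearMap.id - σ.toLinearMap with hf
    have hfV : LinearMap.range f = V := by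
      rw [LinearMap.range_eq_map, ← hspan, Submodule.map_span, ← Set.range_comp, hV]
      congr 1
      ext x
      simp [hf, hσ]
    have hW : 2 * Module.finrank ℚ (LinearMap.ker f) ≤ Module.finrank ℚ L := by
      refine two_mul_finrank_ker_id_sub_le σ (z := ψ 1) fun h => hj ?_
      rw [hσ, mul_one] at h
      exact hinj h
    have := f.finrank_range_add_finrank_ker
    rw [hfV] at this
    omega
  · obtain ⟨t, ht0, ht⟩ : ∃ t : ZMod n, t ≠ 0 ∧ j * t = 0 := by
      by_contra! h
      refine hu (isUnit_iff_mem_nonZeroDivisors_of_finite.2 ?_)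
      rw [mem_nonZeroDivisors_iff_right]
      intro x hx
      by_contra hx0
      exact h x hx0 (by rwa [mul_comm])
    have hψt : ψ t - 1 ≠ 0 := by
      rw [sub_ne_zero, ← AddChar.map_zero_eq_one ψ]
      exact fun h => ht0 (hinj h)
    have hle : LinearMap.range (LinearMap.mulLeft ℚ (ψ t - 1)) ≤ V := by
      rw [LinearMap.range_eq_map, ← hspan, Submodule.map_span, ← Set.range_comp, hV,
        Submodule.span_le]
      rintro _ ⟨s, rfl⟩
      have h1 : (fun s => ψ s - ψ (j * s)) (t + s) ∈ V := Submodule.subset_span ⟨_, rfl⟩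
      have h2 : (fun s => ψ s - ψ (j * s)) s ∈ V := Submodule.subset_span ⟨_, rfl⟩
      have h3 := V.sub_mem h1 h2
      simp only [mul_add, ht, zero_add, AddChar.map_add_eq_mul, sub_sub_sub_cancel_right] at h3
      simpa [sub_mul] using h3
    have hfr := Submodule.finrank_mono hle
    rw [LinearMap.finrank_range_of_inj (mul_right_injective₀ hψt), hfin] at hfr
    omega

/-- A nontrivial unit of `ZMod n` fixes at most half of the residues, and at most a third of them
if `n` is odd. -/
theorem card_filter_units_mul_eq_self_le {n : ℕ} [NeZero n] {u : (ZMod n)ˣ} (hu : u ≠ 1) :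
    2 * (Finset.univ.filter fun x : ZMod n => u * x = x).card ≤ n ∧
      (Odd n → 3 * (Finset.univ.filter fun x : ZMod n => u * x = x).card ≤ n) := by
  set F := Finset.univ.filter fun x : ZMod n => u * x = x with hF
  let A : AddSubgroup (ZMod n) := (AddMonoidHom.mulLeft ((u : ZMod n) - 1)).ker
  have hmem (x : ZMod n) : x ∈ A ↔ (u : ZMod n) * x = x := by
    simp [A, AddMonoidHom.mem_ker, sub_mul, sub_eq_zero]
  have hA : Nat.card A = F.card := by
    rw [← SetLike.coe_sort_coe, Nat.card_coe_set_eq, ← Set.ncard_coe_finset]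
    congr 1
    ext x
    simp [hF, hmem]
  obtain ⟨m, hm⟩ : F.card ∣ n := by
    rw [← hA]
    simpa using A.card_addSubgroup_dvd_card
  have hne : m ≠ 1 := by
    rintro rfl
    have : F = Finset.univ := by
      rw [← Finset.card_eq_iff_eq_univ, ZMod.card]
      omega
    have h1 : (1 : ZMod n) ∈ F := this ▸ Finset.mem_univ _
    rw [hF, Finset.mem_filter, mul_one] at h1
    exact hu (Units.ext h1.2)
  have h0 : m ≠ 0 := by
    rintro rfl
    exact NeZero.ne n (by simpa using hm)
  refine ⟨?_, fun hodd => ?_⟩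
  · have : 2 ≤ m := by omega
    nlinarith
  · have : m ≠ 2 := by
      rintro rfl
      rw [hm] at hodd
      exact Nat.not_odd_iff_even.2 (even_two.mul_left _) hodd
    have : 3 ≤ m := by omega
    nlinarith

/-- The number of sets invariant under a permutation is at most `2 ^ k` for some `k` bounded by the
number of fixed points plus half of the number of moved points. -/
theorem card_filter_image_eq_self_le {α : Type*} [Fintype α] [DecidableEq α] (σ : Equiv.Perm α) :
    ∃ k : ℕ, (Finset.univ.filter fun S : Finset α => S.image σ = S).card ≤ 2 ^ k ∧
      2 * k ≤ Fintype.card α + (Finset.univ.filter fun x => σ x = x).card := by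
  classical
  set e := Fintype.equivFin α
  set J := Finset.univ.filter fun x : α => ∀ i : ℕ, e x ≤ e ((σ ^ i) x) with hJ
  refine ⟨J.card, ?_, ?_⟩
  · rw [← Finset.card_powerset]
    refine Finset.card_le_card_of_injOn (fun S => S ∩ J) (fun S _ => by simp) ?_
    intro S hS T hT hST
    simp only [Finset.coe_filter, Finset.mem_univ, true_and, Set.mem_ofPred_eq] at hS hT hST
    have hpow {S : Finset α} (hS : S.image σ = S) (i : ℕ) (x : α) : (σ ^ i) x ∈ S ↔ x ∈ S := by
      induction i with
      | zero => simp
      | succ i ih =>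
        rw [pow_succ', Equiv.Perm.mul_apply, ← ih]
        conv_lhs => rw [← hS]
        simp
    ext x
    obtain ⟨i, hi⟩ : ∃ i : ℕ, (σ ^ i) x ∈ J := by
      obtain ⟨_, ⟨i, rfl⟩, hi⟩ := (Set.range fun i : ℕ => e ((σ ^ i) x)).toFinite.exists_minimal
        (Set.range_nonempty _)
      refine ⟨i, ?_⟩
      rw [hJ, Finset.mem_filter]
      refine ⟨Finset.mem_univ _, fun m => ?_⟩
      rw [← Equiv.Perm.mul_apply, ← pow_add]
      exact (le_total _ _).elim id fun h => hi ⟨_, rfl⟩ h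
    have := congrArg ((σ ^ i) x ∈ ·) hST
    simp only [Finset.mem_inter, hi, and_true, eq_iff_iff] at this
    rw [← hpow hS i, ← hpow hT i, this]
  · set F := Finset.univ.filter fun x => σ x = x with hF
    have h1 : (J \ F).card ≤ Jᶜ.card := by
      refine Finset.card_le_card_of_injOn σ ?_ σ.injective.injOn
      intro x hx
      simp only [hJ, hF, Finset.coe_sdiff, Finset.coe_filter, Finset.mem_univ, true_and,
        Set.mem_sdiff, Set.mem_ofPred_eq] at hx
      simp only [hJ, Finset.coe_compl, Finset.coe_filter, Finset.mem_univ, true_and,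
        Set.mem_compl_iff, Set.mem_ofPred_eq]
      intro h
      have h2 := h (orderOf σ - 1)
      rw [← Equiv.Perm.mul_apply, ← pow_succ, Nat.sub_add_cancel (orderOf_pos σ),
        pow_orderOf_eq_one, Equiv.Perm.one_apply] at h2
      have h3 := hx.1 1
      rw [pow_one] at h3
      exact hx.2 (e.injective (le_antisymm h2 h3))
    have h2 := Finset.card_le_card_sdiff_add_card (s := J) (t := F)
    have h3 := Finset.card_add_card_compl J
    omega

theorem numIsoClasses_coe (n : ℕ) [DecidableEq (Set (Finset (ZMod n)))]
    (R : Finset (Finset (ZMod n))) :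
    numIsoClasses n (R : Set (Finset (ZMod n))) =
      (R.image fun S => {T : Finset (ZMod n) | CayIso n S T}).card := by
  rw [numIsoClasses, ← Finset.coe_image, Set.ncard_coe_finset]

theorem card_filter_zero_notMem (n : ℕ) [NeZero n] :
    (Finset.univ.filter fun S : Finset (ZMod n) => (0 : ZMod n) ∉ S).card = 2 ^ (n - 1) := by
  have : (Finset.univ.filter fun S : Finset (ZMod n) => (0 : ZMod n) ∉ S) =
      (Finset.univ.erase (0 : ZMod n)).powerset := by
    ext S
    simp [Finset.subset_erase]
  rw [this, Finset.card_powerset, Finset.card_erase_of_mem (Finset.mem_univ _),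
    Finset.card_univ, ZMod.card]

/-- Almost every circulant digraph of order `n` is isomorphic to at most `φ(n)` Cayley digraphs, so
the number of isomorphism classes is asymptotically at least `2 ^ (n - 1) / φ(n)`. -/
theorem exists_two_pow_le_totient_mul_numIsoClasses_add (n : ℕ) [NeZero n] :
    ∃ B r : ℕ, 2 ^ (n - 1) ≤
        n.totient * numIsoClasses n {S : Finset (ZMod n) | (0 : ZMod n) ∉ S} + B ∧
      B * 2 ^ r ≤ n * 2 ^ n ∧ n.totient ≤ 2 * r := by
  classical
  have : IsCyclotomicExtension {n} ℚ (CyclotomicField n ℚ) :=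
    CyclotomicField.isCyclotomicExtension n ℚ
  set ζ := IsCyclotomicExtension.zeta n ℚ (CyclotomicField n ℚ)
  have hζ : IsPrimitiveRoot ζ n := IsCyclotomicExtension.zeta_spec n ℚ (CyclotomicField n ℚ)
  set ψ := AddChar.zmodChar n hζ.pow_eq_one with hψ
  set bad : ZMod n → Finset (Finset (ZMod n)) := fun j =>
    Finset.univ.filter fun S => ∑ s ∈ S, (ψ s - ψ (j * s)) = 0 with hbad
  set B := (Finset.univ.erase (1 : ZMod n)).biUnion bad with hB
  set C := Finset.univ.filter fun S : Finset (ZMod n) => (0 : ZMod n) ∉ S with hC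
  refine ⟨B.card, (n.totient + 1) / 2, ?_, ?_, by omega⟩
  · have hCset : {S : Finset (ZMod n) | (0 : ZMod n) ∉ S} = (C : Set (Finset (ZMod n))) := by
      ext S
      simp [hC]
    rw [hCset, numIsoClasses_coe, ← card_filter_zero_notMem n, ← hC]
    have h1 : (C \ B).card ≤ n.totient *
        ((C \ B).image fun S => {T : Finset (ZMod n) | CayIso n S T}).card := by
      refine Finset.card_le_mul_card_image _ _ fun b hb => ?_
      obtain ⟨S, hS, rfl⟩ := Finset.mem_image.1 hb
      rw [← ZMod.card_units_eq_totient, ← Finset.card_univ]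
      refine (Finset.card_le_card (t := Finset.univ.image fun u : (ZMod n)ˣ =>
        S.image (u.mulLeft ·)) fun T hT => ?_).trans Finset.card_image_le
      have hST : CayIso n S T := (setOf_cayIso_eq_iff.1 (Finset.mem_filter.1 hT).2).symm
      have hsimple (j : ZMod n) (hj : j ≠ 1) : ∑ s ∈ S, ψ s ≠ ∑ s ∈ S, ψ (j * s) := by
        intro h
        refine (Finset.mem_sdiff.1 hS).2 (Finset.mem_biUnion.2 ⟨j, by simpa using hj, ?_⟩)
        simp [hbad, h]
      obtain ⟨u, rfl⟩ := exists_units_of_cayIso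
        (AddChar.zmodChar_primitive_of_primitive_root n hζ)
        (zmodChar_injective_of_isPrimitiveRoot hζ) hsimple hST
      exact Finset.mem_image_of_mem _ (Finset.mem_univ _)
    have h2 := Finset.card_le_card_sdiff_add_card (s := C) (t := B)
    have h3 : ((C \ B).image fun S => {T : Finset (ZMod n) | CayIso n S T}).card ≤
        (C.image fun S => {T : Finset (ZMod n) | CayIso n S T}).card :=
      Finset.card_le_card (Finset.image_subset_image Finset.sdiff_subset)
    have h4 := Nat.mul_le_mul_left n.totient h3
    omega
  · have hj (j : ZMod n) (h : j ∈ Finset.univ.erase (1 : ZMod n)) :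
        (bad j).card * 2 ^ ((n.totient + 1) / 2) ≤ 2 ^ n := by
      have h1 := totient_le_two_mul_finrank_span hζ (Finset.ne_of_mem_erase h)
      rw [← hψ] at h1
      have h2 := card_sum_eq_zero_mul_two_pow_finrank_le (fun s : ZMod n => ψ s - ψ (j * s))
      rw [ZMod.card] at h2
      refine le_trans (Nat.mul_le_mul_left _ (Nat.pow_le_pow_right two_pos ?_)) h2
      omega
    calc B.card * 2 ^ ((n.totient + 1) / 2)
        ≤ (∑ j ∈ Finset.univ.erase (1 : ZMod n), (bad j).card) * 2 ^ ((n.totient + 1) / 2) := by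
          gcongr
          exact Finset.card_biUnion_le
      _ ≤ ∑ j ∈ Finset.univ.erase (1 : ZMod n), 2 ^ n := by
          rw [Finset.sum_mul]
          exact Finset.sum_le_sum hj
      _ ≤ n * 2 ^ n := by
          rw [Finset.sum_const, smul_eq_mul]
          gcongr
          refine (Finset.card_le_univ _).trans_eq (ZMod.card n)

theorem card_exists_image_units_eq_self_le (n : ℕ) [NeZero n] :
    (Finset.univ.filter fun S : Finset (ZMod n) =>
      ∃ u : (ZMod n)ˣ, u ≠ 1 ∧ S.image (u.mulLeft ·) = S).card ≤
      n.totient * 2 ^ (if Even n then 3 * n / 4 else 2 * n / 3) := by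
  classical
  have hunion : (Finset.univ.filter fun S : Finset (ZMod n) =>
      ∃ u : (ZMod n)ˣ, u ≠ 1 ∧ S.image (u.mulLeft ·) = S) ⊆
      (Finset.univ.erase (1 : (ZMod n)ˣ)).biUnion fun u =>
        Finset.univ.filter fun S : Finset (ZMod n) => S.image (u.mulLeft ·) = S := by
    intro S hS
    obtain ⟨u, hu, h⟩ := (Finset.mem_filter.1 hS).2
    exact Finset.mem_biUnion.2 ⟨u, by simpa using hu, by simpa using h⟩
  refine (Finset.card_le_card hunion).trans ((Finset.card_biUnion_le_card_mul _ _ _ ?_).trans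
    (Nat.mul_le_mul_right _
      ((Finset.card_le_univ _).trans_eq (ZMod.card_units_eq_totient n))))
  intro u hu
  obtain ⟨k, hk, hk'⟩ := card_filter_image_eq_self_le u.mulLeft
  obtain ⟨h2, h3⟩ := card_filter_units_mul_eq_self_le (Finset.ne_of_mem_erase hu)
  simp only [ZMod.card, Units.mulLeft_apply] at hk'
  refine hk.trans (Nat.pow_le_pow_right two_pos ?_)
  split_ifs with he
  · omega
  · have := h3 (Nat.not_even_iff_odd.1 he)
    omega

/-- An isomorphism class containing a set with trivial stabilizer in the group of units has at least
`φ(n)` members. -/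
theorem totient_mul_numIsoClasses_le {n : ℕ} [NeZero n] {R : Set (Finset (ZMod n))}
    (hR : ∀ S ∈ R, (0 : ZMod n) ∉ S)
    (hR' : ∀ S ∈ R, ∀ T : Finset (ZMod n), (0 : ZMod n) ∉ T → CayIso n S T → T ∈ R) :
    n.totient * numIsoClasses n R ≤ R.ncard + n.totient *
      (Finset.univ.filter fun S : Finset (ZMod n) =>
        ∃ u : (ZMod n)ˣ, u ≠ 1 ∧ S.image (u.mulLeft ·) = S).card := by
  classical
  obtain ⟨R, rfl⟩ := R.toFinite.exists_finset_coe
  set D := Finset.univ.filter fun S : Finset (ZMod n) =>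
    ∃ u : (ZMod n)ˣ, u ≠ 1 ∧ S.image (u.mulLeft ·) = S with hD
  set f : Finset (ZMod n) → Set (Finset (ZMod n)) := fun S => {T | CayIso n S T} with hf
  rw [numIsoClasses_coe, Set.ncard_coe_finset]
  have h1 : (R.image f).card ≤ ((R \ D).image f).card + D.card := by
    calc (R.image f).card ≤ ((R \ D).image f ∪ D.image f).card := by
          rw [← Finset.image_union]
          refine Finset.card_le_card (Finset.image_subset_image fun S hS => ?_)
          by_cases h : S ∈ D <;> simp [h, hS]
      _ ≤ _ := (Finset.card_union_le _ _).trans (Nat.add_le_add_left Finset.card_image_le _)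
  have h2 : n.totient * ((R \ D).image f).card ≤ R.card := by
    refine le_trans (Finset.mul_card_image_le_card_of_maps_to
      (s := R.filter fun S => f S ∈ (R \ D).image f) (f := f)
      (fun S hS => (Finset.mem_filter.1 hS).2) _ fun b hb => ?_)
      (Finset.card_le_card (Finset.filter_subset _ _))
    obtain ⟨S, hS, rfl⟩ := Finset.mem_image.1 hb
    obtain ⟨hSR, hSD⟩ := Finset.mem_sdiff.1 hS
    rw [← ZMod.card_units_eq_totient, ← Finset.card_univ]
    refine Finset.card_le_card_of_injOn (fun u : (ZMod n)ˣ => S.image (u.mulLeft ·)) ?_ ?_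
    · intro u _
      have hiso := cayIso_image_units_mul u S
      have hfeq : f (S.image (u.mulLeft ·)) = f S := setOf_cayIso_eq_iff.2 hiso.symm
      simp only [Finset.coe_filter, Set.mem_ofPred_eq, Finset.mem_filter, hfeq, hb, and_true]
      exact hR' S hSR _ (fun h => hR S hSR (hiso.zero_mem_iff.2 h)) hiso
    · intro u _ v _ huv
      by_contra hne
      refine hSD (Finset.mem_filter.2 ⟨Finset.mem_univ _, v⁻¹ * u, ?_, ?_⟩)
      · rwa [Ne, inv_mul_eq_one, eq_comm]
      · have := congrArg (Finset.image (v⁻¹.mulLeft ·)) huv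
        simpa [Finset.image_image, Function.comp_def, mul_assoc] using this
  nlinarith [Nat.mul_le_mul_left n.totient h1]

theorem four_mul_totient_sq_mul_two_pow_le {n : ℕ} (hn : 24 ≤ n) :
    4 * (n.totient : ℝ) ^ 2 * 2 ^ (if Even n then 3 * n / 4 else 2 * n / 3) ≤
      (n : ℝ) ^ 2 * (2 : ℝ) ^ (-(n : ℝ) / 4) * 2 ^ n := by
  have hpow : (2 : ℝ) ^ (-(n : ℝ) / 4) * 2 ^ n = (2 : ℝ) ^ (3 * (n : ℝ) / 4) := by
    rw [← Real.rpow_natCast 2 n, ← Real.rpow_add two_pos]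
    congr 1
    ring
  rw [mul_assoc _ _ ((2 : ℝ) ^ n), hpow]
  split_ifs with he
  · have h1 : 2 * (n.totient : ℝ) ≤ n := by exact_mod_cast two_mul_totient_le he
    have h2 : (2 : ℝ) ^ (3 * n / 4) ≤ (2 : ℝ) ^ (3 * (n : ℝ) / 4) := by
      rw [← Real.rpow_natCast]
      refine Real.rpow_le_rpow_of_exponent_le one_le_two ?_
      exact_mod_cast Nat.cast_div_le (α := ℝ)
    gcongr
    calc 4 * (n.totient : ℝ) ^ 2 = (2 * n.totient) ^ 2 := by ring
      _ ≤ _ := by gcongr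
  · have h1 : (n.totient : ℝ) ≤ n := by exact_mod_cast Nat.totient_le n
    have h2 : 4 * (2 : ℝ) ^ (2 * n / 3) ≤ (2 : ℝ) ^ (3 * (n : ℝ) / 4) := by
      have h3 : ((2 * n / 3 : ℕ) : ℝ) ≤ 2 * n / 3 := by
        exact_mod_cast Nat.cast_div_le (α := ℝ)
      have h4 : (24 : ℝ) ≤ n := by exact_mod_cast hn
      calc 4 * (2 : ℝ) ^ (2 * n / 3) = (2 : ℝ) ^ (((2 * n / 3 : ℕ) : ℝ) + 2) := by
            rw [Real.rpow_add two_pos, Real.rpow_natCast]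
            norm_num [mul_comm]
        _ ≤ _ := Real.rpow_le_rpow_of_exponent_le one_le_two (by linarith)
    calc 4 * (n.totient : ℝ) ^ 2 * 2 ^ (2 * n / 3)
        = (n.totient : ℝ) ^ 2 * (4 * 2 ^ (2 * n / 3)) := by ring
      _ ≤ _ := by gcongr

/-- The proportion of connection sets whose digraph has a non-simple eigenvalue at a faithful
character tends to zero. -/
theorem exists_forall_two_mul_le_mul_two_pow {δ : ℝ} (hδ : 0 < δ) :
    ∃ N : ℕ, ∀ n r : ℕ, N ≤ n → n.totient ≤ 2 * r → 2 * (n : ℝ) ≤ δ * 2 ^ r := by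
  have hlim := tendsto_pow_const_div_const_pow_of_one_lt 2 (one_lt_two (α := ℝ))
  obtain ⟨r₀, hr₀⟩ := Filter.eventually_atTop.1
    (hlim.eventually_lt_const (by positivity : (0 : ℝ) < δ / 16))
  refine ⟨8 * r₀ ^ 2, fun n r hn hr => ?_⟩
  have h1 : n ≤ 8 * r ^ 2 := by
    have := le_two_mul_totient_sq_s14 n
    nlinarith [Nat.pow_le_pow_left hr 2]
  have h2 : r₀ ≤ r := by
    by_contra! h
    nlinarith
  have h3 := hr₀ r h2
  rw [div_lt_iff₀ (by positivity)] at h3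
  have h4 : (n : ℝ) ≤ 8 * r ^ 2 := by exact_mod_cast h1
  linarith

/-- Transition from random Cayley digraphs to random unlabeled circulant digraphs:
for every `ε > 0` and all sufficiently large `n`, if `R` is an isomorphism-invariant
family of connection sets, then the fraction of isomorphism classes lying in `R`
is at most `(1+ε)·|R|·2^{-(n-1)} + n²·2^{-n/4}`. -/
theorem stmt14 :
    ∀ ε : ℝ, 0 < ε → ∃ N : ℕ, ∀ n : ℕ, N ≤ n →
      ∀ R : Set (Finset (ZMod n)),
        (∀ S ∈ R, (0 : ZMod n) ∉ S) →
        (∀ S ∈ R, ∀ T : Finset (ZMod n), (0 : ZMod n) ∉ T → CayIso n S T → T ∈ R) →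
        (numIsoClasses n R : ℝ) /
            (numIsoClasses n {S : Finset (ZMod n) | (0 : ZMod n) ∉ S}) ≤
          (1 + ε) * R.ncard / 2 ^ (n - 1) + (n : ℝ) ^ 2 * (2 : ℝ) ^ (-(n : ℝ) / 4) := by
  intro ε hε
  obtain ⟨δ, hδ, hδ2, hδε⟩ : ∃ δ : ℝ, 0 < δ ∧ δ ≤ 1 / 2 ∧ 1 ≤ (1 - δ) * (1 + ε) := by
    refine ⟨min (1 / 2) (ε / (1 + ε)), by positivity, min_le_left _ _, ?_⟩
    calc (1 : ℝ) = (1 - ε / (1 + ε)) * (1 + ε) := by field_simp; ring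
      _ ≤ _ := by gcongr; exact min_le_right _ _
  obtain ⟨N, hN⟩ := exists_forall_two_mul_le_mul_two_pow hδ
  refine ⟨max N 24, fun n hn R hR hR' => ?_⟩
  have hn24 : 24 ≤ n := (le_max_right _ _).trans hn
  have : NeZero n := ⟨by omega⟩
  obtain ⟨B, r, hC, hB, hr⟩ := exists_two_pow_le_totient_mul_numIsoClasses_add n
  have hnr := hN n r ((le_max_left _ _).trans hn) hr
  have hU := (totient_mul_numIsoClasses_le hR hR').trans (Nat.add_le_add_left
    (Nat.mul_le_mul_left _ (card_exists_image_units_eq_self_le n)) _)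
  have hK := four_mul_totient_sq_mul_two_pow_le hn24
  have hP : (0 : ℝ) < n.totient := by exact_mod_cast Nat.totient_pos.2 (by omega)
  generalize (if Even n then 3 * n / 4 else 2 * n / 3) = K at hU hK
  set u := numIsoClasses n {S : Finset (ZMod n) | (0 : ZMod n) ∉ S}
  set q : ℝ := (n : ℝ) ^ 2 * (2 : ℝ) ^ (-(n : ℝ) / 4) with hq
  have hq0 : 0 ≤ q := by positivity
  have hM : (2 : ℝ) ^ n = 2 * 2 ^ (n - 1) := by
    rw [← pow_succ', Nat.sub_add_cancel (by omega)]
  have hM0 : (0 : ℝ) < 2 ^ (n - 1) := by positivity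
  rw [hM] at hK
  generalize hMM : (2 : ℝ) ^ (n - 1) = M at *
  have hBM : (B : ℝ) ≤ δ * M := by
    have h1 : (B : ℝ) * 2 ^ r ≤ n * (2 * M) := by rw [← hM]; exact_mod_cast hB
    refine le_of_mul_le_mul_right (h1.trans ?_) (by positivity : (0 : ℝ) < 2 ^ r)
    nlinarith
  have hPu : (1 - δ) * M ≤ n.totient * u := by
    have h1 : M ≤ n.totient * u + B := by rw [← hMM]; exact_mod_cast hC
    linarith
  have hPuR : (n.totient : ℝ) * numIsoClasses n R ≤
      R.ncard + n.totient * (n.totient * 2 ^ K) := by exact_mod_cast hU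
  have hu : (0 : ℝ) < u :=
    pos_of_mul_pos_right ((by nlinarith : (0 : ℝ) < (1 - δ) * M).trans_le hPu) hP.le
  rw [div_le_iff₀ hu]
  refine le_of_mul_le_mul_left (hPuR.trans ?_) hP
  calc (R.ncard : ℝ) + n.totient * (n.totient * 2 ^ K)
      ≤ (1 - δ) * (1 + ε) * R.ncard + q * ((1 - δ) * M) := by
        refine add_le_add (le_mul_of_one_le_left (Nat.cast_nonneg _) hδε) ?_
        nlinarith [mul_nonneg hq0 hM0.le]
    _ = ((1 + ε) * R.ncard / M + q) * ((1 - δ) * M) := by field_simp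
    _ ≤ ((1 + ε) * R.ncard / M + q) * (n.totient * u) := by gcongr
    _ = _ := by ring
end
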